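/- arXiv:2208.03965 — 3 statements merged into one kernel-verified Lean document; each statement's English description precedes it below -/
import Mathlib

section
/- Let α > 0, b₀ > 0, β = b₀/α, and for ε ∈ (0,1] let μ₀, μ₁ ∈ C²([0,1]) be the unique solutions of -ε μ'' + α x μ' + b₀ μ = 0 on (0,1) with μ₀(0) = 0, μ₀(1) = 1 and μ₁(0) = 1, μ₁(1) = 0. Then there exists a constant C₀ ≥ 1 such that for each integer k ≥ 0 there is C > 0 with, for all ε ∈ (0,1]: (i) for 0 ≤ x ≤ C₀√ε, |μ₀^{(k)}(x)| ≤ C exp(-α/(2ε)) ε^{(β-k-1)/2} and |μ₁^{(k)}(x)| ≤ C ε^{-k/2}; (ii) for C₀√ε ≤ x ≤ 1, |μ₀^{(k)}(x)| ≤ C ( exp(-α/(2ε)) ε^{β - 1/2} x^{-β-k} + ε^{-k} exp(-α(1-x²)/(2ε)) x^{β+k-1} ) and |μ₁^{(k)}(x)| ≤ C ( ε^{β/2} x^{-β-k} + exp(-α(1-x²)/(2ε)) ε^{β/2 - k} x^{β+k-1} ). -/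
open Set
open MeasureTheory Filter Topology

/-- The integral `∫₀^∞ t^(a-1) exp(-t²/2 + s t) dt`, a parabolic cylinder function of `-s`
up to normalization. -/
noncomputable def weberIntegral (a s : ℝ) : ℝ :=
  ∫ t in Ioi (0 : ℝ), t ^ (a - 1) * Real.exp (-t ^ 2 / 2 + s * t)

namespace weberIntegral

theorem integrableOn {a : ℝ} (ha : 0 < a) (s : ℝ) :
    IntegrableOn (fun t : ℝ => t ^ (a - 1) * Real.exp (-t ^ 2 / 2 + s * t)) (Ioi 0) := by
  have h := ((integrable_rpow_mul_exp_neg_mul_sq (b := 1 / 4) (by norm_num)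
    (s := a - 1) (by linarith)).integrableOn (s := Ioi 0)).const_mul (Real.exp (s ^ 2))
  refine h.mono' ?_ ?_
  · refine ContinuousOn.aestronglyMeasurable ?_ measurableSet_Ioi
    intro t ht
    have : t ≠ 0 := ne_of_gt ht
    exact ((Real.continuousAt_rpow_const t _ (Or.inl this)).mul
      (by fun_prop)).continuousWithinAt
  · filter_upwards [ae_restrict_mem measurableSet_Ioi] with t ht
    have ht : 0 < t := ht
    have h1 : 0 ≤ t ^ (a - 1) := by positivity
    rw [Real.norm_of_nonneg (by positivity), mul_left_comm, ← Real.exp_add]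
    refine mul_le_mul_of_nonneg_left (Real.exp_le_exp.2 ?_) h1
    nlinarith [sq_nonneg (s - t / 2)]

theorem hasDerivAt {a : ℝ} (ha : 0 < a) (s : ℝ) :
    HasDerivAt (weberIntegral a) (weberIntegral (a + 1) s) s := by
  have h := hasDerivAt_integral_of_dominated_loc_of_deriv_le
    (μ := volume.restrict (Ioi (0 : ℝ))) (𝕜 := ℝ) (x₀ := s) (s := Metric.ball s 1)
    (F := fun s t : ℝ => t ^ (a - 1) * Real.exp (-t ^ 2 / 2 + s * t))
    (F' := fun s t : ℝ => t ^ (a + 1 - 1) * Real.exp (-t ^ 2 / 2 + s * t))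
    (bound := fun t : ℝ => t ^ (a + 1 - 1) * Real.exp (-t ^ 2 / 2 + (s + 1) * t))
    (Metric.ball_mem_nhds s one_pos)
    (Eventually.of_forall fun r => (integrableOn ha r).aestronglyMeasurable)
    (integrableOn ha s)
    (integrableOn (by linarith) s).aestronglyMeasurable
    ?_ (integrableOn (by linarith) (s + 1)) ?_
  · exact h.2
  · filter_upwards [ae_restrict_mem measurableSet_Ioi] with t ht r hr
    have ht : 0 < t := ht
    have hr : r ≤ s + 1 := by
      rw [Metric.mem_ball, Real.dist_eq] at hr
      linarith [(abs_lt.1 hr).2]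
    rw [Real.norm_of_nonneg (by positivity)]
    gcongr
  · filter_upwards [ae_restrict_mem measurableSet_Ioi] with t ht r _
    have ht : 0 < t := ht
    have h1 : HasDerivAt (fun r : ℝ => -t ^ 2 / 2 + r * t) t r := by
      simpa using ((hasDerivAt_id r).mul_const t).const_add (-t ^ 2 / 2)
    refine (h1.exp.const_mul (t ^ (a - 1))).congr_deriv ?_
    rw [show a + 1 - 1 = (a - 1) + 1 by ring, Real.rpow_add_one ht.ne']
    ring

theorem recurrence {a : ℝ} (ha : 0 < a) (s : ℝ) :
    weberIntegral (a + 2) s = s * weberIntegral (a + 1) s + a * weberIntegral a s := by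
  have i0 := (integrableOn ha s).const_mul a
  have i1 := (integrableOn (a := a + 1) (by linarith) s).const_mul s
  have i2 := integrableOn (a := a + 2) (by linarith) s
  have i3 := (i0.add i1).sub i2
  have hd : ∀ t ∈ Ioi (0 : ℝ), HasDerivAt
      (fun t : ℝ => t ^ (a + 1 - 1) * Real.exp (-t ^ 2 / 2 + s * t))
      (a * (t ^ (a - 1) * Real.exp (-t ^ 2 / 2 + s * t)) +
        s * (t ^ (a + 1 - 1) * Real.exp (-t ^ 2 / 2 + s * t)) -
        t ^ (a + 2 - 1) * Real.exp (-t ^ 2 / 2 + s * t)) t := by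
    intro t ht
    have ht : 0 < t := ht
    have h1 : HasDerivAt (fun t : ℝ => -t ^ 2 / 2 + s * t) (-t + s) t := by
      have := (((hasDerivAt_pow 2 t).neg).div_const 2).add ((hasDerivAt_id t).const_mul s)
      exact this.congr_deriv (by ring)
    refine ((Real.hasDerivAt_rpow_const (p := a + 1 - 1) (Or.inl ht.ne')).mul h1.exp).congr_deriv ?_
    rw [show a + 2 - 1 = a + 1 by ring, show a + 1 - 1 = a by ring, Real.rpow_add_one ht.ne']
    ring
  have h := integral_Ioi_of_hasDerivAt_of_tendsto (m := 0) ?_ hd i3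
    (tendsto_zero_of_hasDerivAt_of_integrableOn_Ioi hd i3 (integrableOn (by linarith) s))
  · have e : ∫ t in Ioi (0 : ℝ), (a * (t ^ (a - 1) * Real.exp (-t ^ 2 / 2 + s * t)) +
        s * (t ^ (a + 1 - 1) * Real.exp (-t ^ 2 / 2 + s * t)) -
        t ^ (a + 2 - 1) * Real.exp (-t ^ 2 / 2 + s * t)) =
        a * weberIntegral a s + s * weberIntegral (a + 1) s - weberIntegral (a + 2) s := by
      refine (integral_sub (i0.add i1) i2).trans ?_
      rw [integral_add' i0 i1, integral_const_mul, integral_const_mul]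
      rfl
    rw [e] at h
    rw [Real.zero_rpow (by linarith)] at h
    linarith
  · have : ContinuousAt (fun t : ℝ => t ^ (a + 1 - 1)) 0 :=
      Real.continuousAt_rpow_const 0 _ (Or.inr (by linarith))
    exact (this.mul (by fun_prop)).continuousWithinAt

theorem le_of_le {a s r : ℝ} (ha : 0 < a) (h : s ≤ r) :
    weberIntegral a s ≤ weberIntegral a r := by
  refine setIntegral_mono_on (integrableOn ha s) (integrableOn ha r) measurableSet_Ioi ?_
  intro t ht
  have ht : 0 < t := ht
  gcongr

theorem pos {a : ℝ} (ha : 0 < a) (s : ℝ) : 0 < weberIntegral a s := by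
  refine (setIntegral_pos_iff_support_of_nonneg_ae ?_ (integrableOn ha s)).2 ?_
  · filter_upwards [ae_restrict_mem measurableSet_Ioi] with t ht
    have ht : 0 < t := ht
    simp only [Pi.zero_apply]
    positivity
  · rw [inter_eq_right.2]
    · simp
    · intro t ht
      have ht : 0 < t := ht
      rw [Function.mem_support]
      positivity

theorem strictMono {a : ℝ} (ha : 0 < a) : StrictMono (weberIntegral a) :=
  strictMono_of_deriv_pos fun s => by
    rw [(hasDerivAt ha s).deriv]
    exact pos (by linarith) s

theorem deriv_eq {a : ℝ} (ha : 0 < a) : deriv (weberIntegral a) = weberIntegral (a + 1) :=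
  funext fun s => (hasDerivAt ha s).deriv

theorem iteratedDeriv_eq (k : ℕ) {a : ℝ} (ha : 0 < a) :
    iteratedDeriv k (weberIntegral a) = weberIntegral (a + k) := by
  induction k generalizing a with
  | zero => simp
  | succ k ih =>
    rw [iteratedDeriv_succ', deriv_eq ha, ih (by linarith)]
    congr 1
    push_cast
    ring

theorem contDiff {a : ℝ} (ha : 0 < a) (n : ℕ) : ContDiff ℝ n (weberIntegral a) := by
  refine contDiff_of_differentiable_iteratedDeriv fun m _ => ?_
  rw [iteratedDeriv_eq m ha]
  exact fun s => (hasDerivAt (by positivity) s).differentiableAt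

theorem succ_le {a s : ℝ} (ha : 0 < a) (hs : 0 < s) :
    weberIntegral (a + 1) s ≤ (s + a / s) * weberIntegral a s := by
  have key : weberIntegral (a + 1) s ≤
      s / 2 * weberIntegral a s + 1 / (2 * s) * weberIntegral (a + 2) s := by
    have i0 := (integrableOn ha s).const_mul (s / 2)
    have i2 := (integrableOn (a := a + 2) (by linarith) s).const_mul (1 / (2 * s))
    unfold weberIntegral
    rw [← integral_const_mul, ← integral_const_mul, ← integral_add i0 i2]
    refine setIntegral_mono_on (integrableOn (by linarith) s) (i0.add i2) measurableSet_Ioi ?_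
    intro t ht
    have ht : 0 < t := ht
    rw [show a + 1 - 1 = (a - 1) + 1 by ring, show a + 2 - 1 = (a - 1) + 1 + 1 by ring,
      Real.rpow_add_one ht.ne' (a - 1 + 1), Real.rpow_add_one ht.ne']
    have h1 : t ≤ s / 2 + 1 / (2 * s) * t ^ 2 := by
      have : s / 2 + 1 / (2 * s) * t ^ 2 - t = (s - t) ^ 2 / (2 * s) := by
        field_simp
        ring
      have : 0 ≤ (s - t) ^ 2 / (2 * s) := by positivity
      linarith
    have h2 : 0 ≤ t ^ (a - 1) * Real.exp (-t ^ 2 / 2 + s * t) := by positivity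
    calc _ = _ := by ring
      _ ≤ _ := mul_le_mul_of_nonneg_left h1 h2
      _ = _ := by ring
  rw [recurrence ha] at key
  have e : 1 / (2 * s) * (s * weberIntegral (a + 1) s + a * weberIntegral a s) =
      weberIntegral (a + 1) s / 2 + a / s / 2 * weberIntegral a s := by
    field_simp
  rw [e] at key
  linarith

theorem le_succ {a s : ℝ} (ha : 0 < a) (hs : 0 < s) :
    weberIntegral a s ≤ (a + 1) / a * (s⁻¹ * weberIntegral (a + 1) s) := by
  have h := succ_le (a := a + 1) (by linarith) hs
  rw [show a + 1 + 1 = a + 2 by ring, recurrence ha] at h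
  have e : (a + 1) / a * (s⁻¹ * weberIntegral (a + 1) s) =
    ((a + 1) / s * weberIntegral (a + 1) s) / a := by field_simp
  rw [e, le_div_iff₀ ha]
  linarith

theorem exists_add_nat_le {a s₀ : ℝ} (ha : 0 < a) (hs₀ : 0 < s₀) (n : ℕ) :
    ∃ C > 0, ∀ s, s₀ ≤ s → weberIntegral (a + n) s ≤ C * (s ^ (n : ℝ) * weberIntegral a s) := by
  induction n with
  | zero => exact ⟨1, one_pos, fun s _ => by simp⟩
  | succ n ih =>
    obtain ⟨C, hC, h⟩ := ih
    refine ⟨(1 + (a + n) / s₀ ^ 2) * C, by positivity, fun s hs => ?_⟩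
    have hs0 : 0 < s := by linarith
    have h1 := succ_le (a := a + n) (by positivity) hs0
    have h2 : s + (a + n) / s ≤ (1 + (a + n) / s₀ ^ 2) * s := by
      have : (a + n) / s = (a + n) / s ^ 2 * s := by field_simp
      rw [this, add_mul, one_mul]
      gcongr
    push_cast
    rw [← add_assoc, Real.rpow_add_one hs0.ne']
    calc _ ≤ _ := h1
      _ ≤ ((1 + (a + n) / s₀ ^ 2) * s) * (C * (s ^ (n : ℝ) * weberIntegral a s)) := by
        gcongr
        · exact (pos (by positivity) s).le
        · exact h s hs
      _ = _ := by ring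

theorem exists_le_add_nat {a s₀ : ℝ} (ha : 0 < a) (hs₀ : 0 < s₀) (n : ℕ) :
    ∃ C > 0, ∀ s, s₀ ≤ s →
      weberIntegral a s ≤ C * (s ^ (-(n : ℝ)) * weberIntegral (a + n) s) := by
  induction n with
  | zero => exact ⟨1, one_pos, fun s _ => by simp⟩
  | succ n ih =>
    obtain ⟨C, hC, h⟩ := ih
    refine ⟨C * ((a + n + 1) / (a + n)), by positivity, fun s hs => ?_⟩
    have hs0 : 0 < s := by linarith
    have h1 := le_succ (a := a + n) (by positivity) hs0
    push_cast
    rw [← add_assoc, neg_add, Real.rpow_add hs0, Real.rpow_neg_one]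
    calc _ ≤ _ := h s hs
      _ ≤ C * (s ^ (-(n : ℝ)) * ((a + n + 1) / (a + n) *
          (s⁻¹ * weberIntegral (a + n + 1) s))) := by gcongr
      _ = _ := by ring

theorem exists_le_rpow_of_le {a b s₀ : ℝ} (ha : 0 < a) (hab : a ≤ b) (hs₀ : 0 < s₀) :
    ∃ C > 0, ∀ s, s₀ ≤ s → weberIntegral b s ≤ C * (s ^ (b - a) * weberIntegral a s) := by
  obtain ⟨n, hn⟩ := exists_nat_ge (b - a)
  obtain ⟨C, hC, h⟩ := exists_add_nat_le ha hs₀ n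
  refine ⟨1 + C, by positivity, fun s hs => ?_⟩
  have hs0 : 0 < s := by linarith
  have key : weberIntegral b s ≤ s ^ (b - a) * weberIntegral a s +
      s ^ (b - a - n) * weberIntegral (a + n) s := by
    have i0 := (integrableOn ha s).const_mul (s ^ (b - a))
    have i2 := (integrableOn (a := a + n) (by positivity) s).const_mul (s ^ (b - a - n))
    unfold weberIntegral
    rw [← integral_const_mul, ← integral_const_mul, ← integral_add i0 i2]
    refine setIntegral_mono_on (integrableOn (by linarith) s) (i0.add i2) measurableSet_Ioi ?_
    intro t ht
    have ht : 0 < t := ht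
    rw [show a + n - 1 = (a - 1) + n by ring, show b - 1 = (a - 1) + (b - a) by ring,
      Real.rpow_add ht, Real.rpow_add ht, Real.rpow_sub hs0 (b - a) n]
    have h1 : t ^ (b - a) ≤ s ^ (b - a) + s ^ (b - a) / s ^ (n : ℝ) * t ^ (n : ℝ) := by
      rcases le_total t s with hts | hts
      · have : t ^ (b - a) ≤ s ^ (b - a) := Real.rpow_le_rpow ht.le hts (by linarith)
        have : 0 ≤ s ^ (b - a) / s ^ (n : ℝ) * t ^ (n : ℝ) := by positivity
        linarith
      · have h3 : (t / s) ^ (b - a) ≤ (t / s) ^ (n : ℝ) :=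
          Real.rpow_le_rpow_of_exponent_le ((one_le_div hs0).2 hts) hn
        rw [Real.div_rpow ht.le hs0.le, Real.div_rpow ht.le hs0.le,
          div_le_iff₀ (by positivity)] at h3
        have : 0 ≤ s ^ (b - a) := by positivity
        calc _ ≤ _ := h3
          _ = s ^ (b - a) / s ^ (n : ℝ) * t ^ (n : ℝ) := by ring
          _ ≤ _ := by linarith
    have h2 : 0 ≤ t ^ (a - 1) * Real.exp (-t ^ 2 / 2 + s * t) := by positivity
    calc _ = _ := by ring
      _ ≤ _ := mul_le_mul_of_nonneg_left h1 h2
      _ = _ := by ring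
  have h1 : s ^ (b - a - n) * weberIntegral (a + n) s ≤
      s ^ (b - a - n) * (C * (s ^ (n : ℝ) * weberIntegral a s)) := by
    gcongr
    exact h s hs
  have e : s ^ (b - a - n) * (C * (s ^ (n : ℝ) * weberIntegral a s)) =
      C * (s ^ (b - a) * weberIntegral a s) := by
    rw [Real.rpow_sub hs0]
    field_simp
  linarith

theorem exists_le_rpow {a b s₀ : ℝ} (ha : 0 < a) (hb : 0 < b) (hs₀ : 0 < s₀) :
    ∃ C > 0, ∀ s, s₀ ≤ s → weberIntegral b s ≤ C * (s ^ (b - a) * weberIntegral a s) := by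
  obtain ⟨n, hn⟩ := exists_nat_ge (a - b)
  obtain ⟨C, hC, h⟩ := exists_le_add_nat hb hs₀ n
  obtain ⟨C', hC', h'⟩ := exists_le_rpow_of_le (b := b + n) ha (by linarith) hs₀
  refine ⟨C * C', by positivity, fun s hs => ?_⟩
  have hs0 : 0 < s := by linarith
  calc _ ≤ _ := h s hs
    _ ≤ C * (s ^ (-(n : ℝ)) * (C' * (s ^ (b + n - a) * weberIntegral a s))) := by
      gcongr
      exact h' s hs
    _ = C * C' * ((s ^ (-(n : ℝ)) * s ^ (b + n - a)) * weberIntegral a s) := by ring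
    _ = _ := by
      rw [← Real.rpow_add hs0, show -(n : ℝ) + (b + n - a) = b - a by ring, mul_assoc]

theorem one_eq (s : ℝ) : weberIntegral 1 s =
    Real.exp (s ^ 2 / 2) * ∫ t in Ioi (0 : ℝ), Real.exp (-(1 / 2) * (t - s) ^ 2) := by
  rw [weberIntegral, ← integral_const_mul]
  congr 1
  ext t
  rw [sub_self, Real.rpow_zero, one_mul, ← Real.exp_add]
  congr 1
  ring

theorem integrable_gaussian_shift (s : ℝ) :
    Integrable fun t : ℝ => Real.exp (-(1 / 2) * (t - s) ^ 2) :=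
  (integrable_exp_neg_mul_sq (b := 1 / 2) (by norm_num)).comp_sub_right s

theorem one_le (s : ℝ) :
    weberIntegral 1 s ≤ √(Real.pi / (1 / 2)) * Real.exp (s ^ 2 / 2) := by
  rw [one_eq, mul_comm]
  gcongr
  calc _ ≤ ∫ t : ℝ, Real.exp (-(1 / 2) * (t - s) ^ 2) :=
        setIntegral_le_integral (integrable_gaussian_shift s)
          (Eventually.of_forall fun t => (Real.exp_pos _).le)
    _ = ∫ t : ℝ, Real.exp (-(1 / 2) * t ^ 2) :=
        integral_sub_right_eq_self (fun t : ℝ => Real.exp (-(1 / 2) * t ^ 2)) s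
    _ = _ := integral_gaussian _

theorem le_one {s : ℝ} (hs : 0 ≤ s) :
    Real.exp (s ^ 2 / 2) ≤ Real.exp (1 / 2) * weberIntegral 1 s := by
  have h : Real.exp (-(1 / 2)) ≤ ∫ t in Ioi (0 : ℝ), Real.exp (-(1 / 2) * (t - s) ^ 2) := by
    calc Real.exp (-(1 / 2)) = Real.exp (-(1 / 2)) * volume.real (Ioc s (s + 1)) := by simp
      _ ≤ ∫ t in Ioc s (s + 1), Real.exp (-(1 / 2) * (t - s) ^ 2) := by
        refine setIntegral_ge_of_const_le_real measurableSet_Ioc (by simp) ?_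
          (integrable_gaussian_shift s).integrableOn
        intro t ht
        gcongr
        nlinarith [ht.1, ht.2]
      _ ≤ _ := by
        refine setIntegral_mono_set (integrable_gaussian_shift s).integrableOn
          (Eventually.of_forall fun t => (Real.exp_pos _).le) ?_
        exact LE.le.eventuallyLE fun t ht => lt_of_le_of_lt hs ht.1
  rw [one_eq]
  calc Real.exp (s ^ 2 / 2)
      = Real.exp (1 / 2) * (Real.exp (s ^ 2 / 2) * Real.exp (-(1 / 2))) := by
        rw [← Real.exp_add, ← Real.exp_add]
        congr 1
        ring
    _ ≤ _ := by gcongr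

theorem exists_le_exp {a s₀ : ℝ} (ha : 0 < a) (hs₀ : 0 < s₀) :
    ∃ C > 0, ∀ s, s₀ ≤ s → weberIntegral a s ≤ C * (Real.exp (s ^ 2 / 2) * s ^ (a - 1)) := by
  obtain ⟨C, hC, h⟩ := exists_le_rpow one_pos ha hs₀
  refine ⟨C * √(Real.pi / (1 / 2)), by positivity, fun s hs => ?_⟩
  have hs0 : 0 < s := by linarith
  calc _ ≤ _ := h s hs
    _ ≤ C * (s ^ (a - 1) * (√(Real.pi / (1 / 2)) * Real.exp (s ^ 2 / 2))) := by
      gcongr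
      exact one_le s
    _ = _ := by ring

theorem exists_exp_le {a s₀ : ℝ} (ha : 0 < a) (hs₀ : 0 < s₀) :
    ∃ C > 0, ∀ s, s₀ ≤ s → Real.exp (s ^ 2 / 2) * s ^ (a - 1) ≤ C * weberIntegral a s := by
  obtain ⟨C, hC, h⟩ := exists_le_rpow ha one_pos hs₀
  refine ⟨Real.exp (1 / 2) * C, by positivity, fun s hs => ?_⟩
  have hs0 : 0 < s := by linarith
  calc _ ≤ (Real.exp (1 / 2) * (C * (s ^ (1 - a) * weberIntegral a s))) * s ^ (a - 1) := by
        gcongr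
        exact (le_one hs0.le).trans (by gcongr; exact h s hs)
    _ = Real.exp (1 / 2) * C * ((s ^ (1 - a) * s ^ (a - 1)) * weberIntegral a s) := by ring
    _ = _ := by
      rw [← Real.rpow_add hs0]
      simp

theorem neg_le {a s : ℝ} (ha : 0 < a) (hs : 0 < s) :
    weberIntegral a (-s) ≤ Real.Gamma a * s ^ (-a) := by
  have h := Real.integral_rpow_mul_exp_neg_mul_Ioi ha hs
  rw [mul_comm, Real.rpow_neg hs.le, ← Real.inv_rpow hs.le, ← one_div, ← h]
  have hi : IntegrableOn (fun t : ℝ => t ^ (a - 1) * Real.exp (-(s * t))) (Ioi 0) := by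
    by_contra hn
    rw [integral_undef hn] at h
    have := Real.Gamma_pos_of_pos ha
    have : 0 < (1 / s) ^ a * Real.Gamma a := by positivity
    linarith
  refine setIntegral_mono_on (integrableOn ha _) hi measurableSet_Ioi ?_
  intro t ht
  have ht : 0 < t := ht
  gcongr
  nlinarith [sq_nonneg t]

end weberIntegral

/-- Where `f` agrees with a smooth function `g` on a closed interval, each iterated derivative of
`f`, endpoints included, is either that of `g` or the default value `0`. -/
theorem abs_iteratedDeriv_le_of_eqOn_Icc {f g : ℝ → ℝ} {a b : ℝ} (hab : a < b)
    (hg : ∀ n : ℕ, ContDiff ℝ n g) (hfg : EqOn f g (Icc a b)) (k : ℕ) {x : ℝ}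
    (hx : x ∈ Icc a b) : |iteratedDeriv k f x| ≤ |iteratedDeriv k g x| := by
  have hIoo : ∀ k : ℕ, EqOn (iteratedDeriv k f) (iteratedDeriv k g) (Ioo a b) := fun k y hy =>
    Filter.EventuallyEq.iteratedDeriv_eq k
      (eventually_of_mem (Icc_mem_nhds hy.1 hy.2) hfg)
  suffices iteratedDeriv k f x = iteratedDeriv k g x ∨ iteratedDeriv k f x = 0 by
    rcases this with h | h <;> simp [h]
  cases k with
  | zero => simpa using Or.inl (hfg hx)
  | succ k =>
    by_cases hd : DifferentiableAt ℝ (iteratedDeriv k f) x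
    · left
      have hgd : Differentiable ℝ (iteratedDeriv k g) :=
        (hg (k + 1)).differentiable_iteratedDeriv k (by exact_mod_cast Nat.lt_succ_self k)
      have hcl : x ∈ closure (Ioo a b) := by rwa [closure_Ioo hab.ne]
      have hne : (𝓝[Ioo a b] x).NeBot := mem_closure_iff_nhdsWithin_neBot.1 hcl
      have hval : iteratedDeriv k f x = iteratedDeriv k g x :=
        tendsto_nhds_unique_of_eventuallyEq
          (hd.continuousAt.continuousWithinAt (s := Ioo a b))
          (hgd.continuous.continuousAt.continuousWithinAt (s := Ioo a b))
          (eventually_of_mem self_mem_nhdsWithin (hIoo k))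
      have hu : UniqueDiffWithinAt ℝ (Ioo a b) x :=
        uniqueDiffWithinAt_convex (convex_Ioo a b) (by simpa using hab) hcl
      rw [iteratedDeriv_succ, iteratedDeriv_succ]
      exact hu.eq_deriv _
        ((hd.hasDerivAt.hasDerivWithinAt (s := Ioo a b)).congr
          (fun y hy => (hIoo k hy).symm) hval.symm)
        (hgd x).hasDerivAt.hasDerivWithinAt
    · right
      rw [iteratedDeriv_succ]
      exact deriv_zero_of_not_differentiableAt hd

/-- One-sided maximum principle for `-ε w'' + p w' + q w = 0` with `q > 0`. -/
theorem nonpos_of_ode {ε q : ℝ} {p w : ℝ → ℝ} (hε : 0 < ε) (hq : 0 < q)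
    (hc : ContinuousOn w (Icc 0 1))
    (hode : ∀ x ∈ Ioo (0 : ℝ) 1, -ε * deriv (deriv w) x + p x * deriv w x + q * w x = 0)
    (h0 : w 0 = 0) (h1 : w 1 = 0) {x : ℝ} (hx : x ∈ Icc (0 : ℝ) 1) : w x ≤ 0 := by
  obtain ⟨m, hm, hmax⟩ := isCompact_Icc.exists_isMaxOn ⟨x, hx⟩ hc
  refine (hmax hx).trans ?_
  by_contra! hpos
  have hm0 : m ≠ 0 := fun h => by simp [h, h0] at hpos
  have hm1 : m ≠ 1 := fun h => by simp [h, h1] at hpos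
  have hm' : m ∈ Ioo (0 : ℝ) 1 := ⟨lt_of_le_of_ne hm.1 hm0.symm, lt_of_le_of_ne hm.2 hm1⟩
  have hnhds : Icc (0 : ℝ) 1 ∈ 𝓝 m := Icc_mem_nhds hm'.1 hm'.2
  have hloc : IsLocalMax w m := hmax.isLocalMax hnhds
  have hd := hloc.deriv_eq_zero
  have hdd : 0 < deriv (deriv w) m := by
    have := hode m hm'
    rw [hd] at this
    have h2 : 0 < q * w m := by positivity
    have h3 : 0 < ε * deriv (deriv w) m := by linarith
    exact pos_of_mul_pos_right h3 hε.le
  have hmin := isLocalMin_of_deriv_deriv_pos hdd hd (hc.continuousAt hnhds)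
  have hconst : w =ᶠ[𝓝 m] fun _ => w m := by
    filter_upwards [hloc, hmin] with y h1 h2 using le_antisymm h1 h2
  rw [hconst.deriv.deriv_eq] at hdd
  simp at hdd

theorem eqOn_of_ode {ε q : ℝ} {p f g : ℝ → ℝ} (hε : 0 < ε) (hq : 0 < q)
    (hf : ContDiffOn ℝ 2 f (Icc 0 1)) (hg : ContDiffOn ℝ 2 g (Icc 0 1))
    (hfe : ∀ x ∈ Ioo (0 : ℝ) 1, -ε * deriv (deriv f) x + p x * deriv f x + q * f x = 0)
    (hge : ∀ x ∈ Ioo (0 : ℝ) 1, -ε * deriv (deriv g) x + p x * deriv g x + q * g x = 0)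
    (h0 : f 0 = g 0) (h1 : f 1 = g 1) : EqOn f g (Icc 0 1) := by
  have key : ∀ f g : ℝ → ℝ, ContDiffOn ℝ 2 f (Icc 0 1) → ContDiffOn ℝ 2 g (Icc 0 1) →
      (∀ x ∈ Ioo (0 : ℝ) 1, -ε * deriv (deriv f) x + p x * deriv f x + q * f x = 0) →
      (∀ x ∈ Ioo (0 : ℝ) 1, -ε * deriv (deriv g) x + p x * deriv g x + q * g x = 0) →
      f 0 = g 0 → f 1 = g 1 → ∀ x ∈ Icc (0 : ℝ) 1, f x ≤ g x := by
    intro f g hf hg hfe hge h0 h1 x hx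
    have hdiff : ∀ {f : ℝ → ℝ}, ContDiffOn ℝ 2 f (Icc 0 1) → ∀ y ∈ Ioo (0 : ℝ) 1,
        DifferentiableAt ℝ f y ∧ DifferentiableAt ℝ (deriv f) y := by
      intro f hf y hy
      have hfy : ContDiffAt ℝ 2 f y := hf.contDiffAt (Icc_mem_nhds hy.1 hy.2)
      exact ⟨hfy.differentiableAt (by norm_num),
        (hfy.derivWithin (m := 1) (by norm_num)).differentiableAt (by norm_num)⟩
    have hd : ∀ y ∈ Ioo (0 : ℝ) 1, deriv (f - g) y = deriv f y - deriv g y := fun y hy =>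
      deriv_sub (hdiff hf y hy).1 (hdiff hg y hy).1
    have hw := nonpos_of_ode (w := f - g) (p := p) hε hq (hf.continuousOn.sub hg.continuousOn)
      (fun y hy => by
        have hdd : deriv (deriv (f - g)) y = deriv (deriv f) y - deriv (deriv g) y := by
          have : deriv (f - g) =ᶠ[𝓝 y] deriv f - deriv g :=
            eventually_of_mem (isOpen_Ioo.mem_nhds hy) hd
          rw [this.deriv_eq]
          exact deriv_sub (hdiff hf y hy).2 (hdiff hg y hy).2
        rw [hdd, hd y hy, Pi.sub_apply]
        linarith [hfe y hy, hge y hy])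
      (by simp [h0]) (by simp [h1]) hx
    simpa using hw
  exact fun x hx => le_antisymm (key f g hf hg hfe hge h0 h1 x hx)
    (key g f hg hf hge hfe h0.symm h1.symm x hx)

/-- The odd solution, vanishing at zero, of the homogeneous equation in the stretched variable. -/
noncomputable def oddWeber (β s : ℝ) : ℝ := weberIntegral β s - weberIntegral β (-s)

theorem iteratedDeriv_weberIntegral_neg (k : ℕ) {β : ℝ} (hβ : 0 < β) (s : ℝ) :
    iteratedDeriv k (fun s => weberIntegral β (-s)) s =
      (-1) ^ k * weberIntegral (β + k) (-s) := by
  rw [iteratedDeriv_comp_neg, weberIntegral.iteratedDeriv_eq k hβ, smul_eq_mul]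

theorem contDiff_weberIntegral_neg {β : ℝ} (hβ : 0 < β) (n : ℕ) :
    ContDiff ℝ n fun s => weberIntegral β (-s) :=
  (weberIntegral.contDiff hβ n).comp contDiff_neg

namespace oddWeber

theorem contDiff {β : ℝ} (hβ : 0 < β) (n : ℕ) : ContDiff ℝ n (oddWeber β) :=
  (weberIntegral.contDiff hβ n).sub (contDiff_weberIntegral_neg hβ n)

theorem iteratedDeriv_eq (k : ℕ) {β : ℝ} (hβ : 0 < β) (s : ℝ) :
    iteratedDeriv k (oddWeber β) s =
      weberIntegral (β + k) s - (-1) ^ k * weberIntegral (β + k) (-s) := by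
  rw [← iteratedDeriv_weberIntegral_neg k hβ, ← weberIntegral.iteratedDeriv_eq k hβ]
  exact iteratedDeriv_sub (weberIntegral.contDiff hβ k).contDiffAt
    (contDiff_weberIntegral_neg hβ k).contDiffAt

theorem abs_iteratedDeriv_le (k : ℕ) {β s : ℝ} (hβ : 0 < β) (hs : 0 ≤ s) :
    |iteratedDeriv k (oddWeber β) s| ≤ 2 * weberIntegral (β + k) s := by
  rw [iteratedDeriv_eq k hβ]
  have hk : 0 < β + k := by positivity
  have h1 := weberIntegral.le_of_le hk (show -s ≤ s by linarith)
  have h2 := weberIntegral.pos hk s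
  have h3 := weberIntegral.pos hk (-s)
  refine (abs_sub _ _).trans ?_
  rw [abs_mul, abs_pow, abs_neg, abs_one, one_pow, one_mul, abs_of_pos h2, abs_of_pos h3]
  linarith

theorem zero (β : ℝ) : oddWeber β 0 = 0 := by simp [oddWeber]

theorem pos {β s : ℝ} (hβ : 0 < β) (hs : 0 < s) : 0 < oddWeber β s :=
  sub_pos.2 (weberIntegral.strictMono hβ (by linarith))

theorem le_of_le {β s r : ℝ} (hβ : 0 < β) (h : s ≤ r) : oddWeber β s ≤ oddWeber β r :=
  sub_le_sub (weberIntegral.le_of_le hβ h) (weberIntegral.le_of_le hβ (by linarith))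

theorem exists_exp_le {β s₀ : ℝ} (hβ : 0 < β) (hs₀ : 0 < s₀) :
    ∃ C > 0, ∀ s, s₀ ≤ s → Real.exp (s ^ 2 / 2) * s ^ (β - 1) ≤ C * oddWeber β s := by
  obtain ⟨C, hC, h⟩ := weberIntegral.exists_exp_le hβ hs₀
  have hp := pos hβ hs₀
  have hw := weberIntegral.pos hβ (-s₀)
  refine ⟨C * (1 + weberIntegral β (-s₀) / oddWeber β s₀), by positivity, fun s hs => ?_⟩
  refine (h s hs).trans ?_
  rw [mul_assoc]
  gcongr
  have h1 : weberIntegral β (-s) ≤ weberIntegral β (-s₀) :=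
    weberIntegral.le_of_le hβ (by linarith)
  have h2 : weberIntegral β (-s₀) ≤ weberIntegral β (-s₀) / oddWeber β s₀ * oddWeber β s := by
    rw [div_mul_eq_mul_div, le_div_iff₀ hp]
    exact mul_le_mul_of_nonneg_left (le_of_le hβ hs) hw.le
  have h3 : weberIntegral β s = oddWeber β s + weberIntegral β (-s) := by simp [oddWeber]
  rw [h3]
  linarith

end oddWeber

theorem weber_ode_comp_mul {ε α β σ : ℝ} {f : ℝ → ℝ} (hσ : ε * σ ^ 2 = α)
    (hf : ∀ s, iteratedDeriv 2 f s = s * iteratedDeriv 1 f s + β * f s)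
    (hd : ContDiff ℝ 2 f) (x : ℝ) :
    -ε * deriv (deriv fun x => f (σ * x)) x + α * x * deriv (fun x => f (σ * x)) x +
      α * β * f (σ * x) = 0 := by
  have h2 := congrFun (iteratedDeriv_comp_const_mul (n := 2) hd σ) x
  have h1 := congrFun (iteratedDeriv_comp_const_mul (n := 1) (hd.of_le (by norm_num)) σ) x
  rw [iteratedDeriv_succ, iteratedDeriv_one] at h2
  rw [iteratedDeriv_one] at h1
  rw [h1, h2, hf, ← hσ]
  ring

theorem weberIntegral_neg_ode {β : ℝ} (hβ : 0 < β) (s : ℝ) :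
    iteratedDeriv 2 (fun s => weberIntegral β (-s)) s =
      s * iteratedDeriv 1 (fun s => weberIntegral β (-s)) s + β * weberIntegral β (-s) := by
  have := weberIntegral.recurrence hβ (-s)
  rw [iteratedDeriv_weberIntegral_neg _ hβ, iteratedDeriv_weberIntegral_neg _ hβ]
  push_cast
  linarith

theorem oddWeber_ode {β : ℝ} (hβ : 0 < β) (s : ℝ) :
    iteratedDeriv 2 (oddWeber β) s =
      s * iteratedDeriv 1 (oddWeber β) s + β * oddWeber β s := by
  have h1 := weberIntegral.recurrence hβ (-s)
  have h2 := weberIntegral.recurrence hβ s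
  rw [oddWeber.iteratedDeriv_eq _ hβ, oddWeber.iteratedDeriv_eq _ hβ, oddWeber]
  push_cast
  linarith

namespace oddWeber

theorem inv_le_exp {β s₀ C : ℝ} (hβ : 0 < β) (hs₀ : 0 < s₀)
    (h : ∀ s, s₀ ≤ s → Real.exp (s ^ 2 / 2) * s ^ (β - 1) ≤ C * oddWeber β s)
    {σ : ℝ} (hσ : s₀ ≤ σ) :
    (oddWeber β σ)⁻¹ ≤ C * (Real.exp (-σ ^ 2 / 2) * σ ^ (1 - β)) := by
  have hσ0 : 0 < σ := by linarith
  have hp := pos hβ hσ0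
  rw [inv_le_iff_one_le_mul₀ hp]
  have e : Real.exp (-σ ^ 2 / 2) * σ ^ (1 - β) * (Real.exp (σ ^ 2 / 2) * σ ^ (β - 1)) = 1 := by
    have e1 : Real.exp (-σ ^ 2 / 2) * Real.exp (σ ^ 2 / 2) = 1 := by
      rw [← Real.exp_add]
      simp [neg_div]
    have e2 : σ ^ (1 - β) * σ ^ (β - 1) = 1 := by
      rw [← Real.rpow_add hσ0]
      simp
    calc _ = (Real.exp (-σ ^ 2 / 2) * Real.exp (σ ^ 2 / 2)) * (σ ^ (1 - β) * σ ^ (β - 1)) := by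
          ring
      _ = 1 := by rw [e1, e2, one_mul]
  calc 1 = _ := e.symm
    _ ≤ Real.exp (-σ ^ 2 / 2) * σ ^ (1 - β) * (C * oddWeber β σ) := by
      exact mul_le_mul_of_nonneg_left (h σ hσ) (by positivity)
    _ = _ := by ring

theorem exists_abs_iteratedDeriv_le_inner (k : ℕ) {β s₀ : ℝ} (hβ : 0 < β) (hs₀ : 0 < s₀) :
    ∃ C > 0, ∀ σ, s₀ ≤ σ → ∀ s, 0 ≤ s → s ≤ s₀ →
      |iteratedDeriv k (oddWeber β) s| / oddWeber β σ ≤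
        C * (Real.exp (-σ ^ 2 / 2) * σ ^ (1 - β)) := by
  obtain ⟨C, hC, h⟩ := exists_exp_le hβ hs₀
  have hk : 0 < β + k := by positivity
  have hw := weberIntegral.pos hk s₀
  refine ⟨2 * weberIntegral (β + k) s₀ * C, by positivity, fun σ hσ s hs hs' => ?_⟩
  rw [div_eq_mul_inv, mul_assoc _ C]
  have hp := pos hβ (hs₀.trans_le hσ)
  refine mul_le_mul ?_ (inv_le_exp hβ hs₀ h hσ) (by positivity) (by positivity)
  have := weberIntegral.le_of_le hk hs'
  linarith [abs_iteratedDeriv_le k hβ hs]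

theorem exists_abs_iteratedDeriv_le_outer (k : ℕ) {β s₀ : ℝ} (hβ : 0 < β) (hs₀ : 0 < s₀) :
    ∃ C > 0, ∀ σ, s₀ ≤ σ → ∀ s, s₀ ≤ s →
      |iteratedDeriv k (oddWeber β) s| / oddWeber β σ ≤
        C * (Real.exp (s ^ 2 / 2) * s ^ (β + k - 1) *
          (Real.exp (-σ ^ 2 / 2) * σ ^ (1 - β))) := by
  obtain ⟨C, hC, h⟩ := exists_exp_le hβ hs₀
  have hk : 0 < β + k := by positivity
  obtain ⟨C', hC', h'⟩ := weberIntegral.exists_le_exp hk hs₀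
  refine ⟨2 * C' * C, by positivity, fun σ hσ s hs => ?_⟩
  have hs0 : 0 < s := hs₀.trans_le hs
  have hp := pos hβ (hs₀.trans_le hσ)
  calc _ = |iteratedDeriv k (oddWeber β) s| * (oddWeber β σ)⁻¹ := div_eq_mul_inv _ _
    _ ≤ (2 * (C' * (Real.exp (s ^ 2 / 2) * s ^ (β + k - 1)))) *
        (C * (Real.exp (-σ ^ 2 / 2) * σ ^ (1 - β))) := by
      refine mul_le_mul ?_ (inv_le_exp hβ hs₀ h hσ) (by positivity) (by positivity)
      linarith [abs_iteratedDeriv_le k hβ hs0.le, h' s hs]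
    _ = _ := by ring

end oddWeber

/-- The solution with boundary values `0, 1`, where `σ = √(α/ε)`. -/
noncomputable def weberSol₀ (β σ x : ℝ) : ℝ := oddWeber β (σ * x) / oddWeber β σ

/-- The solution with boundary values `1, 0`, where `σ = √(α/ε)`. -/
noncomputable def weberSol₁ (β σ x : ℝ) : ℝ :=
  (weberIntegral β (-(σ * x)) - weberIntegral β (-σ) * weberSol₀ β σ x) / weberIntegral β 0

section weberSol

variable {β σ : ℝ}

theorem contDiff_weberSol₀ (hβ : 0 < β) (n : ℕ) : ContDiff ℝ n (weberSol₀ β σ) :=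
  ((oddWeber.contDiff hβ n).comp (contDiff_const.mul contDiff_id)).div_const _

theorem contDiff_weberIntegral_neg_mul (hβ : 0 < β) (n : ℕ) :
    ContDiff ℝ n fun x => weberIntegral β (-(σ * x)) :=
  (contDiff_weberIntegral_neg hβ n).comp (contDiff_const.mul contDiff_id)

theorem contDiff_weberSol₁ (hβ : 0 < β) (n : ℕ) : ContDiff ℝ n (weberSol₁ β σ) :=
  ((contDiff_weberIntegral_neg_mul hβ n).sub
    (contDiff_const.mul (contDiff_weberSol₀ hβ n))).div_const _

theorem iteratedDeriv_weberSol₀ (hβ : 0 < β) (k : ℕ) (x : ℝ) :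
    iteratedDeriv k (weberSol₀ β σ) x =
      σ ^ k * (iteratedDeriv k (oddWeber β) (σ * x) / oddWeber β σ) := by
  have h : weberSol₀ β σ = fun x => oddWeber β (σ * x) / oddWeber β σ := rfl
  rw [h, iteratedDeriv_div_const, iteratedDeriv_comp_const_mul (oddWeber.contDiff hβ k),
    mul_div_assoc]

theorem iteratedDeriv_weberIntegral_neg_mul (hβ : 0 < β) (k : ℕ) (x : ℝ) :
    iteratedDeriv k (fun x => weberIntegral β (-(σ * x))) x =
      σ ^ k * ((-1) ^ k * weberIntegral (β + k) (-(σ * x))) := by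
  rw [iteratedDeriv_comp_const_mul (contDiff_weberIntegral_neg hβ k) σ]
  beta_reduce
  rw [iteratedDeriv_weberIntegral_neg k hβ]

theorem iteratedDeriv_weberSol₁ (hβ : 0 < β) (k : ℕ) (x : ℝ) :
    iteratedDeriv k (weberSol₁ β σ) x =
      (σ ^ k * ((-1) ^ k * weberIntegral (β + k) (-(σ * x))) -
        weberIntegral β (-σ) * iteratedDeriv k (weberSol₀ β σ) x) / weberIntegral β 0 := by
  have h : weberSol₁ β σ = fun x => ((fun x => weberIntegral β (-(σ * x))) -
      fun x => weberIntegral β (-σ) * weberSol₀ β σ x) x / weberIntegral β 0 := rfl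
  rw [h, iteratedDeriv_div_const, iteratedDeriv_sub
    (contDiff_weberIntegral_neg_mul hβ k).contDiffAt
    (contDiff_const.mul (contDiff_weberSol₀ hβ k)).contDiffAt,
    iteratedDeriv_const_mul_field, iteratedDeriv_weberIntegral_neg_mul hβ]

theorem weberSol₀_ode {ε α : ℝ} (hβ : 0 < β) (hσ : ε * σ ^ 2 = α) (x : ℝ) :
    -ε * deriv (deriv (weberSol₀ β σ)) x + α * x * deriv (weberSol₀ β σ) x +
      α * β * weberSol₀ β σ x = 0 := by
  have h := weber_ode_comp_mul hσ (oddWeber_ode hβ) (oddWeber.contDiff hβ 2) x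
  have h2 := iteratedDeriv_div_const (n := 2) (x := x) (fun x => oddWeber β (σ * x)) (oddWeber β σ)
  have h1 := iteratedDeriv_div_const (n := 1) (x := x) (fun x => oddWeber β (σ * x)) (oddWeber β σ)
  rw [iteratedDeriv_succ, iteratedDeriv_one, iteratedDeriv_succ, iteratedDeriv_one] at h2
  rw [iteratedDeriv_one, iteratedDeriv_one] at h1
  change deriv (deriv (weberSol₀ β σ)) x = _ at h2
  change deriv (weberSol₀ β σ) x = _ at h1
  rw [h1, h2, weberSol₀]
  linear_combination h / oddWeber β σ

theorem weberSol₁_ode {ε α : ℝ} (hβ : 0 < β) (hσ : ε * σ ^ 2 = α) (x : ℝ) :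
    -ε * deriv (deriv (weberSol₁ β σ)) x + α * x * deriv (weberSol₁ β σ) x +
      α * β * weberSol₁ β σ x = 0 := by
  have h := weber_ode_comp_mul hσ (weberIntegral_neg_ode hβ) (contDiff_weberIntegral_neg hβ 2) x
  have h' := weberSol₀_ode hβ hσ x
  have h2 := iteratedDeriv_weberSol₁ (σ := σ) hβ 2 x
  have h1 := iteratedDeriv_weberSol₁ (σ := σ) hβ 1 x
  rw [← iteratedDeriv_weberIntegral_neg_mul hβ, iteratedDeriv_succ, iteratedDeriv_one,
    iteratedDeriv_succ, iteratedDeriv_one, iteratedDeriv_succ, iteratedDeriv_one] at h2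
  rw [← iteratedDeriv_weberIntegral_neg_mul hβ, iteratedDeriv_one, iteratedDeriv_one,
    iteratedDeriv_one] at h1
  rw [h1, h2, weberSol₁]
  linear_combination (h - weberIntegral β (-σ) * h') / weberIntegral β 0

theorem abs_iteratedDeriv_weberSol₀ (hβ : 0 < β) (hσ : 0 < σ) (k : ℕ) (x : ℝ) :
    |iteratedDeriv k (weberSol₀ β σ) x| =
      σ ^ k * (|iteratedDeriv k (oddWeber β) (σ * x)| / oddWeber β σ) := by
  rw [iteratedDeriv_weberSol₀ hβ, abs_mul, abs_div, abs_of_pos (oddWeber.pos hβ hσ),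
    abs_of_nonneg (by positivity : 0 ≤ σ ^ k)]

theorem abs_iteratedDeriv_weberSol₁_le (hβ : 0 < β) (hσ : 0 < σ) (k : ℕ) (x : ℝ) :
    |iteratedDeriv k (weberSol₁ β σ) x| ≤
      (σ ^ k * weberIntegral (β + k) (-(σ * x)) +
        weberIntegral β (-σ) * |iteratedDeriv k (weberSol₀ β σ) x|) / weberIntegral β 0 := by
  have h0 := weberIntegral.pos hβ 0
  have h1 := weberIntegral.pos hβ (-σ)
  have h2 := weberIntegral.pos (a := β + k) (by positivity) (-(σ * x))
  rw [iteratedDeriv_weberSol₁ hβ, abs_div, abs_of_pos h0]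
  gcongr
  refine (abs_sub _ _).trans (le_of_eq ?_)
  rw [abs_mul, abs_mul, abs_mul, abs_of_pos h1, abs_of_pos h2, abs_pow, abs_pow, abs_neg, abs_one,
    one_pow, one_mul, abs_of_pos hσ]

variable {α ε : ℝ}

theorem sqrt_div_rpow (hα : 0 < α) (hε : 0 < ε) (r : ℝ) :
    √(α / ε) ^ r = α ^ (r / 2) * ε ^ (-r / 2) := by
  rw [Real.sqrt_eq_rpow, ← Real.rpow_mul (by positivity), Real.div_rpow hα.le hε.le, div_eq_mul_inv,
    ← Real.rpow_neg hε.le]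
  congr 2 <;> ring

theorem sqrt_le_sqrt_div (hα : 0 < α) (hε : ε ∈ Ioc (0 : ℝ) 1) : √α ≤ √(α / ε) :=
  Real.sqrt_le_sqrt ((le_div_iff₀ hε.1).2 (mul_le_of_le_one_right hα.le hε.2))

theorem sqrt_div_mul_sqrt (hε : 0 < ε) : √(α / ε) * √ε = √α := by
  rw [← Real.sqrt_mul' _ hε.le, div_mul_cancel₀ _ hε.ne']

theorem exists_weberSol₀_inner (k : ℕ) (hα : 0 < α) (hβ : 0 < β) :
    ∃ C > 0, ∀ ε ∈ Ioc (0 : ℝ) 1, ∀ x, 0 ≤ x → x ≤ √ε →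
      |iteratedDeriv k (weberSol₀ β √(α / ε)) x| ≤
        C * Real.exp (-α / (2 * ε)) * ε ^ ((β - k - 1) / 2) := by
  obtain ⟨C, hC, h⟩ := oddWeber.exists_abs_iteratedDeriv_le_inner k hβ (Real.sqrt_pos.2 hα)
  refine ⟨C * α ^ ((k + 1 - β) / 2), by positivity, fun ε hε x hx hx' => ?_⟩
  have hε0 := hε.1
  have hσ : 0 < √(α / ε) := Real.sqrt_pos.2 (by positivity)
  have hsq : √(α / ε) ^ 2 = α / ε := Real.sq_sqrt (by positivity)
  rw [abs_iteratedDeriv_weberSol₀ hβ hσ]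
  calc _ ≤ √(α / ε) ^ k * (C * (Real.exp (-√(α / ε) ^ 2 / 2) * √(α / ε) ^ (1 - β))) := by
        gcongr
        refine h _ (sqrt_le_sqrt_div hα hε) _ (by positivity) ?_
        rw [← sqrt_div_mul_sqrt (α := α) hε0]
        gcongr
    _ = C * Real.exp (-√(α / ε) ^ 2 / 2) * (√(α / ε) ^ (k : ℝ) * √(α / ε) ^ (1 - β)) := by
        rw [Real.rpow_natCast]
        ring
    _ = _ := by
        rw [← Real.rpow_add hσ, sqrt_div_rpow hα hε0, hsq,
          show -(α / ε) / 2 = -α / (2 * ε) by field_simp,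
          show (k + (1 - β)) / 2 = (k + 1 - β) / 2 by ring,
          show -(k + (1 - β)) / 2 = (β - k - 1) / 2 by ring]
        ring

theorem exists_weberSol₀_outer (k : ℕ) (hα : 0 < α) (hβ : 0 < β) :
    ∃ C > 0, ∀ ε ∈ Ioc (0 : ℝ) 1, ∀ x, √ε ≤ x →
      |iteratedDeriv k (weberSol₀ β √(α / ε)) x| ≤
        C * (ε ^ (-(k : ℝ)) * Real.exp (-α * (1 - x ^ 2) / (2 * ε)) * x ^ (β + k - 1)) := by
  obtain ⟨C, hC, h⟩ := oddWeber.exists_abs_iteratedDeriv_le_outer k hβ (Real.sqrt_pos.2 hα)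
  refine ⟨C * α ^ (k : ℝ), by positivity, fun ε hε x hx => ?_⟩
  have hε0 := hε.1
  have hx0 : 0 < x := (Real.sqrt_pos.2 hε0).trans_le hx
  have hσ : 0 < √(α / ε) := Real.sqrt_pos.2 (by positivity)
  have hsq : √(α / ε) ^ 2 = α / ε := Real.sq_sqrt (by positivity)
  have hE : Real.exp ((√(α / ε) * x) ^ 2 / 2) * Real.exp (-√(α / ε) ^ 2 / 2) =
      Real.exp (-α * (1 - x ^ 2) / (2 * ε)) := by
    rw [← Real.exp_add, mul_pow, hsq]
    congr 1
    field_simp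
    ring
  have hS : √(α / ε) ^ (k : ℝ) * √(α / ε) ^ (β + k - 1) * √(α / ε) ^ (1 - β) =
      α ^ (k : ℝ) * ε ^ (-(k : ℝ)) := by
    rw [← Real.rpow_add hσ, ← Real.rpow_add hσ, sqrt_div_rpow hα hε0]
    congr 2 <;> ring
  rw [abs_iteratedDeriv_weberSol₀ hβ hσ]
  calc _ ≤ √(α / ε) ^ k * (C * (Real.exp ((√(α / ε) * x) ^ 2 / 2) *
        (√(α / ε) * x) ^ (β + k - 1) *
          (Real.exp (-√(α / ε) ^ 2 / 2) * √(α / ε) ^ (1 - β)))) := by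
        gcongr
        refine h _ (sqrt_le_sqrt_div hα hε) _ ?_
        rw [← sqrt_div_mul_sqrt (α := α) hε0]
        gcongr
    _ = C * (Real.exp ((√(α / ε) * x) ^ 2 / 2) * Real.exp (-√(α / ε) ^ 2 / 2)) *
        (√(α / ε) ^ (k : ℝ) * √(α / ε) ^ (β + k - 1) * √(α / ε) ^ (1 - β)) *
          x ^ (β + k - 1) := by
        rw [Real.rpow_natCast, Real.mul_rpow hσ.le hx0.le]
        ring
    _ = _ := by
        rw [hE, hS]
        ring

theorem exists_weberSol₁_inner (k : ℕ) (hα : 0 < α) (hβ : 0 < β) :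
    ∃ C > 0, ∀ ε ∈ Ioc (0 : ℝ) 1, ∀ x, 0 ≤ x → x ≤ √ε →
      |iteratedDeriv k (weberSol₁ β √(α / ε)) x| ≤ C * ε ^ (-(k : ℝ) / 2) := by
  have hk : 0 < β + k := by positivity
  have hw0 := weberIntegral.pos hβ 0
  have hwk := weberIntegral.pos hk 0
  have hwα := weberIntegral.pos hk √α
  have ho := oddWeber.pos hβ (Real.sqrt_pos.2 hα)
  refine ⟨α ^ ((k : ℝ) / 2) * (weberIntegral (β + k) 0 + weberIntegral β 0 *
    (2 * weberIntegral (β + k) √α / oddWeber β √α)) / weberIntegral β 0, by positivity,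
    fun ε hε x hx hx' => ?_⟩
  have hε0 := hε.1
  have hσ : 0 < √(α / ε) := Real.sqrt_pos.2 (by positivity)
  refine (abs_iteratedDeriv_weberSol₁_le hβ hσ k x).trans ?_
  rw [abs_iteratedDeriv_weberSol₀ hβ hσ]
  have hle : √(α / ε) * x ≤ √α := by
    rw [← sqrt_div_mul_sqrt (α := α) hε0]
    gcongr
  have hx'' : 0 ≤ √(α / ε) * x := by positivity
  calc _ ≤ (√(α / ε) ^ k * weberIntegral (β + k) 0 + weberIntegral β 0 *
        (√(α / ε) ^ k * (2 * weberIntegral (β + k) √α / oddWeber β √α))) /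
          weberIntegral β 0 := by
        have hp := oddWeber.pos hβ hσ
        gcongr
        · exact weberIntegral.le_of_le hk (by linarith)
        · exact weberIntegral.le_of_le hβ (by linarith)
        · exact (oddWeber.abs_iteratedDeriv_le k hβ hx'').trans
            (by linarith [weberIntegral.le_of_le hk hle])
        · exact oddWeber.le_of_le hβ (sqrt_le_sqrt_div hα hε)
    _ = √(α / ε) ^ (k : ℝ) * (weberIntegral (β + k) 0 + weberIntegral β 0 *
        (2 * weberIntegral (β + k) √α / oddWeber β √α)) / weberIntegral β 0 := by
        rw [Real.rpow_natCast]
        ring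
    _ = _ := by
        rw [sqrt_div_rpow hα hε0]
        ring

theorem exists_weberSol₁_outer (k : ℕ) (hα : 0 < α) (hβ : 0 < β) :
    ∃ C > 0, ∀ ε ∈ Ioc (0 : ℝ) 1, ∀ x, √ε ≤ x →
      |iteratedDeriv k (weberSol₁ β √(α / ε)) x| ≤
        C * (ε ^ (β / 2) * x ^ (-β - k) +
          Real.exp (-α * (1 - x ^ 2) / (2 * ε)) * ε ^ (β / 2 - k) * x ^ (β + k - 1)) := by
  obtain ⟨C, hC, h⟩ := exists_weberSol₀_outer k hα hβ
  have hk : 0 < β + k := by positivity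
  have hw0 := weberIntegral.pos hβ 0
  have hΓ := Real.Gamma_pos_of_pos hβ
  have hΓk := Real.Gamma_pos_of_pos hk
  refine ⟨α ^ (-β / 2) * (Real.Gamma (β + k) + Real.Gamma β * C) / weberIntegral β 0,
    by positivity, fun ε hε x hx => ?_⟩
  have hε0 := hε.1
  have hx0 : 0 < x := (Real.sqrt_pos.2 hε0).trans_le hx
  have hσ : 0 < √(α / ε) := Real.sqrt_pos.2 (by positivity)
  refine (abs_iteratedDeriv_weberSol₁_le hβ hσ k x).trans ?_
  set A := ε ^ (β / 2) * x ^ (-β - k) with hA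
  set B := Real.exp (-α * (1 - x ^ 2) / (2 * ε)) * ε ^ (β / 2 - k) * x ^ (β + k - 1) with hB
  have hA0 : 0 ≤ A := by positivity
  have hB0 : 0 ≤ B := by positivity
  have hT1 : √(α / ε) ^ k * weberIntegral (β + k) (-(√(α / ε) * x)) ≤
      α ^ (-β / 2) * Real.Gamma (β + k) * A := by
    calc _ ≤ √(α / ε) ^ k * (Real.Gamma (β + k) * (√(α / ε) * x) ^ (-(β + k))) := by
          gcongr
          exact weberIntegral.neg_le hk (by positivity)
      _ = Real.Gamma (β + k) * (√(α / ε) ^ (k : ℝ) * √(α / ε) ^ (-(β + k))) *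
          x ^ (-(β + k)) := by
          rw [Real.mul_rpow hσ.le hx0.le, Real.rpow_natCast]
          ring
      _ = _ := by
          rw [← Real.rpow_add hσ, show k + -(β + k) = -β by ring, sqrt_div_rpow hα hε0,
            neg_neg, neg_add', hA]
          ring
  have hT2 : weberIntegral β (-√(α / ε)) * |iteratedDeriv k (weberSol₀ β √(α / ε)) x| ≤
      α ^ (-β / 2) * (Real.Gamma β * C) * B := by
    calc _ ≤ (Real.Gamma β * √(α / ε) ^ (-β)) *
          (C * (ε ^ (-(k : ℝ)) * Real.exp (-α * (1 - x ^ 2) / (2 * ε)) * x ^ (β + k - 1))) := by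
          gcongr
          · exact weberIntegral.neg_le hβ hσ
          · exact h ε hε x hx
      _ = _ := by
          rw [sqrt_div_rpow hα hε0, neg_neg, hB, sub_eq_add_neg (β / 2), Real.rpow_add hε0]
          ring
  rw [div_mul_eq_mul_div]
  gcongr
  have hα' : 0 < α ^ (-β / 2) := by positivity
  calc _ ≤ α ^ (-β / 2) * Real.Gamma (β + k) * A + α ^ (-β / 2) * (Real.Gamma β * C) * B :=
        add_le_add hT1 hT2
    _ ≤ α ^ (-β / 2) * Real.Gamma (β + k) * (A + B) +
        α ^ (-β / 2) * (Real.Gamma β * C) * (A + B) := by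
        gcongr <;> linarith
    _ = _ := by ring

end weberSol

/-- Two-regime derivative bounds for the homogeneous solutions `μ₀, μ₁` of the
frozen-coefficient operator `L̃ u = -ε u'' + α x u' + b₀ u` (case `p'(0) = α > 0`),
with `β = b₀/α` and transition point `ρ = C₀ √ε`. -/
theorem stmt15 (α b₀ : ℝ) (hα : 0 < α) (hb₀ : 0 < b₀) :
    ∃ C₀ ≥ (1 : ℝ), ∀ k : ℕ, ∃ C > 0, ∀ ε ∈ Ioc (0 : ℝ) 1,
      ∀ μ₀ μ₁ : ℝ → ℝ,
      ContDiffOn ℝ 2 μ₀ (Icc (0 : ℝ) 1) →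
      (∀ x ∈ Ioo (0 : ℝ) 1,
        -ε * deriv (deriv μ₀) x + α * x * deriv μ₀ x + b₀ * μ₀ x = 0) →
      μ₀ 0 = 0 → μ₀ 1 = 1 →
      ContDiffOn ℝ 2 μ₁ (Icc (0 : ℝ) 1) →
      (∀ x ∈ Ioo (0 : ℝ) 1,
        -ε * deriv (deriv μ₁) x + α * x * deriv μ₁ x + b₀ * μ₁ x = 0) →
      μ₁ 0 = 1 → μ₁ 1 = 0 →
      -- (i) inner regime 0 ≤ x ≤ C₀√ε
      (∀ x, 0 ≤ x → x ≤ C₀ * Real.sqrt ε → x ≤ 1 →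
        |iteratedDeriv k μ₀ x| ≤
          C * Real.exp (-α / (2 * ε)) * ε ^ ((b₀ / α - (k : ℝ) - 1) / 2) ∧
        |iteratedDeriv k μ₁ x| ≤ C * ε ^ (-(k : ℝ) / 2)) ∧
      -- (ii) outer regime C₀√ε ≤ x ≤ 1
      (∀ x, C₀ * Real.sqrt ε ≤ x → x ≤ 1 →
        |iteratedDeriv k μ₀ x| ≤
          C * (Real.exp (-α / (2 * ε)) * ε ^ (b₀ / α - 1 / 2) *
              x ^ (-(b₀ / α) - (k : ℝ)) +
            ε ^ (-(k : ℝ)) * Real.exp (-α * (1 - x ^ 2) / (2 * ε)) *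
              x ^ (b₀ / α + (k : ℝ) - 1)) ∧
        |iteratedDeriv k μ₁ x| ≤
          C * (ε ^ (b₀ / α / 2) * x ^ (-(b₀ / α) - (k : ℝ)) +
            Real.exp (-α * (1 - x ^ 2) / (2 * ε)) *
              ε ^ (b₀ / α / 2 - (k : ℝ)) * x ^ (b₀ / α + (k : ℝ) - 1))) := by
  set β := b₀ / α with hβdef
  have hβ : 0 < β := by positivity
  have hαβ : α * β = b₀ := by rw [hβdef]; field_simp
  refine ⟨1, le_rfl, fun k => ?_⟩
  obtain ⟨C₁, hC₁, h₁⟩ := exists_weberSol₀_inner k hα hβ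
  obtain ⟨C₂, hC₂, h₂⟩ := exists_weberSol₁_inner k hα hβ
  obtain ⟨C₃, hC₃, h₃⟩ := exists_weberSol₀_outer k hα hβ
  obtain ⟨C₄, hC₄, h₄⟩ := exists_weberSol₁_outer k hα hβ
  refine ⟨C₁ + C₂ + C₃ + C₄, by positivity, ?_⟩
  intro ε hε μ₀ μ₁ hμ₀ hode₀ h00 h01 hμ₁ hode₁ h10 h11
  have hε0 := hε.1
  have hσ : 0 < √(α / ε) := Real.sqrt_pos.2 (by positivity)
  have hsq : ε * √(α / ε) ^ 2 = α := by
    rw [Real.sq_sqrt (by positivity)]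
    field_simp
  have ho := oddWeber.pos hβ hσ
  have hw := weberIntegral.pos hβ 0
  have h1 : weberSol₀ β √(α / ε) 1 = 1 := by simp [weberSol₀, ho.ne']
  have h0 : weberSol₀ β √(α / ε) 0 = 0 := by simp [weberSol₀, oddWeber.zero]
  have e₀ : EqOn μ₀ (weberSol₀ β √(α / ε)) (Icc 0 1) :=
    eqOn_of_ode (p := fun x => α * x) hε0 hb₀ hμ₀ (contDiff_weberSol₀ hβ 2).contDiffOn hode₀
      (fun x _ => by simpa only [hαβ] using weberSol₀_ode hβ hsq x)
      (by rw [h00, h0]) (by rw [h01, h1])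
  have e₁ : EqOn μ₁ (weberSol₁ β √(α / ε)) (Icc 0 1) :=
    eqOn_of_ode (p := fun x => α * x) hε0 hb₀ hμ₁ (contDiff_weberSol₁ hβ 2).contDiffOn hode₁
      (fun x _ => by simpa only [hαβ] using weberSol₁_ode hβ hsq x)
      (by simp [h10, weberSol₁, h0, hw.ne']) (by simp [h11, weberSol₁, h1])
  have b₀' := fun x => abs_iteratedDeriv_le_of_eqOn_Icc (x := x) one_pos
    (contDiff_weberSol₀ hβ) e₀ k
  have b₁' := fun x => abs_iteratedDeriv_le_of_eqOn_Icc (x := x) one_pos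
    (contDiff_weberSol₁ hβ) e₁ k
  refine ⟨fun x hx hxε hx1 => ?_, fun x hxε hx1 => ?_⟩
  · rw [one_mul] at hxε
    constructor
    · refine (b₀' x ⟨hx, hx1⟩).trans ((h₁ ε hε x hx hxε).trans ?_)
      gcongr
      linarith
    · refine (b₁' x ⟨hx, hx1⟩).trans ((h₂ ε hε x hx hxε).trans ?_)
      gcongr
      linarith
  · rw [one_mul] at hxε
    have hx : 0 < x := (Real.sqrt_pos.2 hε0).trans_le hxε
    constructor
    · refine (b₀' x ⟨hx.le, hx1⟩).trans ((h₃ ε hε x hxε).trans ?_)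
      gcongr
      · linarith
      · exact le_add_of_nonneg_left (by positivity)
    · refine (b₁' x ⟨hx.le, hx1⟩).trans ((h₄ ε hε x hxε).trans ?_)
      gcongr
      linarith
end

section
/- Let α > 0, b₀ > 0, β = b₀/α, and for ε ∈ (0,1] let μ₀, μ₁ ∈ C²([0,1]) be the unique solutions of -ε μ'' - α x μ' + b₀ μ = 0 on (0,1) with μ₀(0) = 0, μ₀(1) = 1 and μ₁(0) = 1, μ₁(1) = 0. Then there exists a constant C₀ ≥ 1 such that for each integer k ≥ 0 there is C > 0 with, for all ε ∈ (0,1]: (i) for 0 ≤ x ≤ C₀√ε, |μ₀^{(k)}(x)| ≤ C ε^{(β-k)/2} and |μ₁^{(k)}(x)| ≤ C ε^{-k/2}; (ii) for C₀√ε ≤ x ≤ 1, |μ₀^{(k)}(x)| ≤ C ( exp(-α x²/(2ε)) ε^{β + 1/2 - k} x^{-β+k-1} + x^{β-k} ) and |μ₁^{(k)}(x)| ≤ C ( exp(-α x²/(2ε)) ε^{(β+1)/2 - k} x^{-β+k-1} + exp(-α/(2ε)) ε^{(β+1)/2} x^{β-k} ). -/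
open Set

namespace TurningPoint

/-- A function on `[0, T]` and its successive derivatives, where the function solves
`u'' + t u' - β u = 0`. -/
structure IsTower (β T : ℝ) (F : ℕ → ℝ → ℝ) : Prop where
  continuousOn : ∀ k, ContinuousOn (F k) (Icc 0 T)
  hasDerivAt : ∀ k, ∀ t ∈ Ioo 0 T, HasDerivAt (F k) (F (k + 1) t) t
  recurrence : ∀ k, ∀ t, F (k + 2) t = (β - k) * F k t - t * F (k + 1) t

/-- Maximum principle for `u'' + t u' - β u`. -/
lemma nonpos_of_subsolution {β T : ℝ} (hβ : 0 < β) (hT : 0 ≤ T) {z z₁ z₂ : ℝ → ℝ}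
    (hc : ContinuousOn z (Icc 0 T))
    (h₁ : ∀ t ∈ Ioo 0 T, HasDerivAt z (z₁ t) t)
    (h₂ : ∀ t ∈ Ioo 0 T, HasDerivAt z₁ (z₂ t) t)
    (hL : ∀ t ∈ Ioo 0 T, 0 ≤ z₂ t + t * z₁ t - β * z t)
    (hz0 : z 0 ≤ 0) (hzT : z T ≤ 0) : ∀ t ∈ Icc 0 T, z t ≤ 0 := by
  obtain ⟨m, hm, hmax⟩ := isCompact_Icc.exists_isMaxOn (nonempty_Icc.2 hT) hc
  suffices z m ≤ 0 from fun t ht => (hmax ht).trans this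
  by_contra! hpos
  have hm0 : m ≠ 0 := fun h => by rw [h] at hpos; linarith
  have hmT : m ≠ T := fun h => by rw [h] at hpos; linarith
  have hmI : m ∈ Ioo 0 T := ⟨lt_of_le_of_ne hm.1 hm0.symm, lt_of_le_of_ne hm.2 hmT⟩
  have hnhds : Ioo 0 T ∈ nhds m := isOpen_Ioo.mem_nhds hmI
  have hlmax : IsLocalMax z m := hmax.isLocalMax (Filter.mem_of_superset hnhds Ioo_subset_Icc_self)
  have hz1 : z₁ m = 0 := hlmax.hasDerivAt_eq_zero (h₁ m hmI)
  have hev : deriv z =ᶠ[nhds m] z₁ := by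
    filter_upwards [hnhds] with t ht using (h₁ t ht).deriv
  have hdd : deriv (deriv z) m = z₂ m := by
    rw [hev.deriv_eq, (h₂ m hmI).deriv]
  have hz2 : 0 < z₂ m := by
    have := hL m hmI
    rw [hz1] at this
    have : 0 < β * z m := mul_pos hβ hpos
    linarith
  have hlmin : IsLocalMin z m := isLocalMin_of_deriv_deriv_pos (by rw [hdd]; exact hz2)
    (by rw [(h₁ m hmI).deriv, hz1]) (h₁ m hmI).continuousAt
  have hconst : z =ᶠ[nhds m] fun _ => z m := by
    filter_upwards [hlmax, hlmin] with t h h' using le_antisymm h h'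
  have h3 : deriv (deriv z) m = 0 := by
    rw [hconst.deriv.deriv_eq]; simp
  linarith

/-- A function with `|f' + t f| ≤ (1 + t)^γ` gains one power: `f = O((1 + t)^(γ - 1))`. -/
lemma le_rpow_of_first_order (γ : ℝ) : ∃ C > 0, ∀ T M : ℝ, 0 ≤ M → ∀ f f₁ : ℝ → ℝ,
    ContinuousOn f (Icc 0 T) → (∀ t ∈ Ioo 0 T, HasDerivAt f (f₁ t) t) →
    (∀ t ∈ Ioo 0 T, f₁ t + t * f t ≤ M * (1 + t) ^ γ) → f 0 ≤ M →
    ∀ t ∈ Icc 0 T, f t ≤ C * M * (1 + t) ^ (γ - 1) := by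
  set p : ℝ := |γ - 1| with hp
  have hp0 : 0 ≤ p := abs_nonneg _
  set l : ℝ := (2 + 2 * p) * (2 + 3 * p) with hl
  have hl0 : 0 < l := by positivity
  refine ⟨4 * Real.exp l, by positivity, ?_⟩
  intro T M hM f f₁ hc hd hle h0 t ht
  let W : ℝ → ℝ := fun t => 4 * Real.exp l * M * ((1 + t) ^ (γ - 1) * Real.exp (-l / (1 + t)))
  let W₁ : ℝ → ℝ := fun t => W t * ((γ - 1) / (1 + t) + l / (1 + t) ^ 2)
  have hW : ∀ t, 0 ≤ t → HasDerivAt W (W₁ t) t := by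
    intro t ht
    have hs : (0 : ℝ) < 1 + t := by linarith
    have e1 : HasDerivAt (fun t : ℝ => 1 + t) 1 t := (hasDerivAt_id t).const_add 1
    have e2 := e1.rpow_const (p := γ - 1) (Or.inl hs.ne')
    have e3 := ((hasDerivAt_const t (-l)).div e1 hs.ne').exp
    have e4 := (e2.mul e3).const_mul (4 * Real.exp l * M)
    refine e4.congr_deriv ?_
    simp only [W₁, W]
    rw [Real.rpow_sub_one hs.ne']
    simp only [Pi.div_apply]
    field_simp
    ring
  have hWpos : ∀ t, 0 ≤ t → 0 ≤ W t := fun t ht => by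
    have hs : (0 : ℝ) < 1 + t := by linarith
    positivity
  have key : ∀ t, 0 ≤ t → M * (1 + t) ^ γ ≤ W₁ t + t * W t := by
    intro t ht
    have hs : (0 : ℝ) < 1 + t := by linarith
    have h1 : (1 + t) / 4 ≤ (γ - 1) / (1 + t) + l / (1 + t) ^ 2 + t := by
      have hg : -p ≤ γ - 1 := neg_abs_le _
      have : (1 + t) ^ 3 / 4 ≤ -p * (1 + t) + l + t * (1 + t) ^ 2 := by
        rcases le_total (1 + t) (2 + 2 * p) with h | h
        · nlinarith [mul_nonneg ht (sq_nonneg (1 + t)), mul_nonneg hp0 hs.le,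
            mul_le_mul_of_nonneg_left h hp0, pow_pos hs 2, pow_pos hs 3, sq_nonneg t,
            mul_le_mul h h hs.le (by positivity)]
        · nlinarith [mul_nonneg ht (sq_nonneg (1 + t)), mul_nonneg hp0 hs.le,
            mul_le_mul_of_nonneg_left h hp0, pow_pos hs 2, pow_pos hs 3, sq_nonneg t,
            mul_le_mul_of_nonneg_left h hs.le,
            mul_le_mul_of_nonneg_left h (sq_nonneg (1 + t))]
      have h2 : (1 + t) ^ 3 / 4 ≤ (γ - 1) * (1 + t) + l + t * (1 + t) ^ 2 := by
        nlinarith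
      have h3 : (γ - 1) / (1 + t) + l / (1 + t) ^ 2 + t
          = ((γ - 1) * (1 + t) + l + t * (1 + t) ^ 2) / (1 + t) ^ 2 := by
        field_simp
      rw [h3, le_div_iff₀ (by positivity)]
      linarith
    have h2 : M * (1 + t) ^ γ ≤ W t * ((1 + t) / 4) := by
      have h3 : (1 + t) ^ γ = (1 + t) ^ (γ - 1) * (1 + t) := by
        rw [← Real.rpow_add_one hs.ne']; ring_nf
      have h4 : 1 ≤ Real.exp l * Real.exp (-l / (1 + t)) := by
        rw [← Real.exp_add]
        apply Real.one_le_exp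
        rw [neg_div, ← sub_eq_add_neg, sub_nonneg]
        exact div_le_self hl0.le (by linarith)
      have h5 : 0 ≤ M * (1 + t) ^ γ := by positivity
      calc M * (1 + t) ^ γ ≤ M * (1 + t) ^ γ * (Real.exp l * Real.exp (-l / (1 + t))) :=
            le_mul_of_one_le_right h5 h4
        _ = W t * ((1 + t) / 4) := by rw [h3]; simp only [W]; ring
    have := mul_le_mul_of_nonneg_left h1 (hWpos t ht)
    simp only [W₁]
    linarith
  let G : ℝ → ℝ := fun t => Real.exp (t ^ 2 / 2) * (W t - f t)
  have hG : MonotoneOn G (Icc 0 T) := by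
    apply monotoneOn_of_hasDerivWithinAt_nonneg (convex_Icc 0 T)
      (f' := fun t => Real.exp (t ^ 2 / 2) * (W₁ t + t * W t - (f₁ t + t * f t)))
    · refine ContinuousOn.mul (by fun_prop) (ContinuousOn.sub ?_ hc)
      exact fun t ht => (hW t ht.1).continuousAt.continuousWithinAt
    · intro t ht
      rw [interior_Icc] at ht
      have e1 : HasDerivAt (fun t : ℝ => Real.exp (t ^ 2 / 2)) (Real.exp (t ^ 2 / 2) * t) t := by
        refine (((hasDerivAt_pow 2 t).div_const 2).exp).congr_deriv ?_
        norm_num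
      refine ((e1.mul ((hW t ht.1.le).sub (hd t ht))).congr_deriv ?_).hasDerivWithinAt
      simp only [Pi.sub_apply]
      ring
    · intro t ht
      rw [interior_Icc] at ht
      have := key t ht.1.le
      have := hle t ht
      exact mul_nonneg (Real.exp_pos _).le (by linarith)
  have hT : 0 ≤ T := ht.1.trans ht.2
  have hG0 : 0 ≤ G 0 := by
    have : W 0 = 4 * M := by
      simp only [W, add_zero, Real.one_rpow, div_one, Real.exp_neg]
      field_simp
    simp only [G, this]
    exact mul_nonneg (Real.exp_pos _).le (by linarith)
  have hGt : 0 ≤ G t := hG0.trans (hG ⟨le_rfl, hT⟩ ht ht.1)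
  have h6 : f t ≤ W t := by
    have := nonneg_of_mul_nonneg_right hGt (Real.exp_pos _)
    linarith
  have hs : (0 : ℝ) < 1 + t := by linarith [ht.1]
  refine h6.trans ?_
  have h7 : Real.exp (-l / (1 + t)) ≤ 1 := by
    rw [Real.exp_le_one_iff]
    exact div_nonpos_of_nonpos_of_nonneg (by linarith) hs.le
  have h8 : (1 + t) ^ (γ - 1) * Real.exp (-l / (1 + t)) ≤ (1 + t) ^ (γ - 1) :=
    mul_le_of_le_one_right (by positivity) h7
  exact mul_le_mul_of_nonneg_left h8 (by positivity)

/-- An interior equation of derivatives propagates to the iterated derivatives of any extension;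
at the endpoints these either agree with the one-sided limits or are the default value `0`. -/
lemma iteratedDeriv_eq_or_eq_zero {u : ℝ → ℝ} {G : ℕ → ℝ → ℝ} {a b : ℝ} (hab : a < b)
    (h0 : ∀ x ∈ Icc a b, u x = G 0 x) (hc : ∀ k, ContinuousOn (G k) (Icc a b))
    (hd : ∀ k, ∀ x ∈ Ioo a b, HasDerivAt (G k) (G (k + 1) x) x) (k : ℕ) :
    ∀ x ∈ Icc a b, iteratedDeriv k u x = G k x ∨ iteratedDeriv k u x = 0 := by
  have hint : ∀ k, ∀ x ∈ Ioo a b, iteratedDeriv k u x = G k x := by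
    intro k
    induction k with
    | zero => exact fun x hx => by simpa using h0 x (Ioo_subset_Icc_self hx)
    | succ k ih =>
      intro x hx
      have : iteratedDeriv k u =ᶠ[nhds x] G k := by
        filter_upwards [isOpen_Ioo.mem_nhds hx] with y hy using ih y hy
      rw [iteratedDeriv_succ, this.deriv_eq, (hd k x hx).deriv]
  intro x hx
  cases k with
  | zero => exact Or.inl (by simpa using h0 x hx)
  | succ k =>
    rw [iteratedDeriv_succ]
    by_cases hdiff : DifferentiableAt ℝ (iteratedDeriv k u) x
    swap
    · exact Or.inr (deriv_zero_of_not_differentiableAt hdiff)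
    left
    have hcl : closure (Ioo a b) = Icc a b := closure_Ioo hab.ne
    have hxc : x ∈ closure (Ioo a b) := hcl ▸ hx
    have hne : (nhdsWithin x (Ioo a b)).NeBot := mem_closure_iff_nhdsWithin_neBot.1 hxc
    have hval : iteratedDeriv k u x = G k x := by
      have t1 : Filter.Tendsto (iteratedDeriv k u) (nhdsWithin x (Ioo a b))
          (nhds (iteratedDeriv k u x)) := hdiff.continuousAt.continuousWithinAt
      have t2 : Filter.Tendsto (G k) (nhdsWithin x (Ioo a b)) (nhds (G k x)) :=
        ((hc k) x hx).mono Ioo_subset_Icc_self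
      refine tendsto_nhds_unique t1 (t2.congr' ?_)
      filter_upwards [self_mem_nhdsWithin] with y hy using (hint k y hy).symm
    have hG : HasFDerivWithinAt (G k) (ContinuousLinearMap.toSpanSingleton ℝ (G (k + 1) x))
        (closure (Ioo a b)) x := by
      apply hasFDerivWithinAt_closure_of_tendsto_fderiv
      · exact fun y hy => (hd k y hy).differentiableAt.differentiableWithinAt
      · exact convex_Ioo a b
      · exact isOpen_Ioo
      · exact fun y hy => ((hc k) y (hcl ▸ hy)).mono Ioo_subset_Icc_self
      · have t2 : Filter.Tendsto (G (k + 1)) (nhdsWithin x (Ioo a b)) (nhds (G (k + 1) x)) :=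
          ((hc (k + 1)) x hx).mono Ioo_subset_Icc_self
        have t3 := ((ContinuousLinearMap.toSpanSingletonCLE (𝕜 := ℝ) (E := ℝ)).continuous.tendsto
          (G (k + 1) x)).comp t2
        refine t3.congr' ?_
        filter_upwards [self_mem_nhdsWithin] with y hy using (hd k y hy).hasFDerivAt.fderiv.symm
    have hGu : HasDerivWithinAt (iteratedDeriv k u) (G (k + 1) x) (Ioo a b) x :=
      ((hG.hasDerivWithinAt.mono subset_closure).congr (fun y hy => hint k y hy) hval).congr_deriv
        (by simp)
    have huniq : UniqueDiffWithinAt ℝ (Ioo a b) x :=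
      uniqueDiffWithinAt_convex (convex_Ioo a b) (by simpa using hab) hxc
    exact huniq.eq_deriv _ hdiff.hasDerivAt.hasDerivWithinAt hGu

/-- Two functions solving the rescaled equation to first order generate a whole tower. -/
def tower (β : ℝ) (f g : ℝ → ℝ) : ℕ → ℝ → ℝ
  | 0 => f
  | 1 => g
  | k + 2 => fun t => (β - k) * tower β f g k t - t * tower β f g (k + 1) t

lemma isTower_tower {β T : ℝ} {f g : ℝ → ℝ} (hf : ContinuousOn f (Icc 0 T))
    (hg : ContinuousOn g (Icc 0 T)) (hfg : ∀ t ∈ Ioo 0 T, HasDerivAt f (g t) t)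
    (hgf : ∀ t ∈ Ioo 0 T, HasDerivAt g (β * f t - t * g t) t) :
    IsTower β T (tower β f g) := by
  have hc : ∀ k, ContinuousOn (tower β f g k) (Icc 0 T) ∧
      ContinuousOn (tower β f g (k + 1)) (Icc 0 T) := by
    intro k
    induction k with
    | zero => exact ⟨hf, hg⟩
    | succ k ih =>
      exact ⟨ih.2, (continuousOn_const.mul ih.1).sub (continuousOn_id.mul ih.2)⟩
  have hd : ∀ k, ∀ t ∈ Ioo 0 T,
      HasDerivAt (tower β f g k) (tower β f g (k + 1) t) t ∧
      HasDerivAt (tower β f g (k + 1)) (tower β f g (k + 2) t) t := by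
    intro k t ht
    induction k with
    | zero => exact ⟨hfg t ht, by simpa [tower] using hgf t ht⟩
    | succ k ih =>
      refine ⟨ih.2, ?_⟩
      refine ((ih.1.const_mul (β - k)).sub ((hasDerivAt_id t).mul ih.2)).congr_deriv ?_
      simp only [tower, id]
      push_cast
      ring
  exact ⟨fun k => (hc k).1, fun k t ht => (hd k t ht).1, fun k t => rfl⟩

/-- A solution of the frozen-coefficient equation, in the stretched variable `t = T x`. -/
lemma exists_isTower {α b ε T : ℝ} (hα : 0 < α) (hT : 0 < T) (hεT : ε * T ^ 2 = α) {u : ℝ → ℝ}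
    (hu : ContDiffOn ℝ 2 u (Icc 0 1))
    (hode : ∀ x ∈ Ioo (0 : ℝ) 1, -ε * deriv (deriv u) x - α * x * deriv u x + b * u x = 0) :
    ∃ F, IsTower (b / α) T F ∧ (∀ t, F 0 t = u (t / T)) ∧
      ∀ k, ∀ x ∈ Icc (0 : ℝ) 1,
        iteratedDeriv k u x = T ^ k * F k (T * x) ∨ iteratedDeriv k u x = 0 := by
  set u₁ : ℝ → ℝ := derivWithin u (Icc 0 1) with hu₁
  have hmaps : MapsTo (fun t => t / T) (Icc 0 T) (Icc 0 1) := fun t ht =>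
    ⟨div_nonneg ht.1 hT.le, (div_le_one hT).2 ht.2⟩
  have hmaps' : ∀ t ∈ Ioo 0 T, t / T ∈ Ioo (0 : ℝ) 1 := fun t ht =>
    ⟨div_pos ht.1 hT, (div_lt_one hT).2 ht.2⟩
  have hu₁c : ContinuousOn u₁ (Icc 0 1) :=
    hu.continuousOn_derivWithin (uniqueDiffOn_Icc zero_lt_one) (by norm_num)
  have hdu : ∀ x ∈ Ioo (0 : ℝ) 1, HasDerivAt u (u₁ x) x := by
    intro x hx
    have hn : Icc (0 : ℝ) 1 ∈ nhds x := Icc_mem_nhds hx.1 hx.2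
    have := (hu.contDiffAt hn).differentiableAt (by norm_num)
    rw [hu₁, derivWithin_of_mem_nhds hn]
    exact this.hasDerivAt
  have hdu₁ : ∀ x ∈ Ioo (0 : ℝ) 1, HasDerivAt u₁ (T ^ 2 * (b / α * u x - x * u₁ x)) x := by
    intro x hx
    have hev : u₁ =ᶠ[nhds x] deriv u := by
      filter_upwards [isOpen_Ioo.mem_nhds hx] with y hy using (hdu y hy).deriv.symm
    have h3 : DifferentiableAt ℝ (deriv u) x :=
      (((hu.mono Ioo_subset_Icc_self).deriv_of_isOpen (m := 1) isOpen_Ioo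
        (by norm_num)).differentiableOn (by norm_num) x hx).differentiableAt
        (isOpen_Ioo.mem_nhds hx)
    refine (h3.hasDerivAt.congr_of_eventuallyEq hev).congr_deriv ?_
    have h5 := hode x hx
    rw [(hdu x hx).deriv] at h5
    have h6 : ε * deriv (deriv u) x = b * u x - α * x * u₁ x := by linarith
    have hε : ε ≠ 0 := by rintro rfl; simp at hεT; exact hα.ne hεT
    apply mul_left_cancel₀ hε
    rw [h6, ← mul_assoc, hεT]
    field_simp
  have hdiv : ∀ t, HasDerivAt (fun t : ℝ => t / T) (1 / T) t := fun t =>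
    (hasDerivAt_id t).div_const T
  have htower : IsTower (b / α) T (tower (b / α) (fun t => u (t / T)) (fun t => u₁ (t / T) / T)) := by
    apply isTower_tower
    · exact hu.continuousOn.comp (by fun_prop) hmaps
    · exact (hu₁c.comp (by fun_prop) hmaps).div_const T
    · intro t ht
      refine ((hdu _ (hmaps' t ht)).comp t (hdiv t)).congr_deriv ?_
      ring
    · intro t ht
      refine (((hdu₁ _ (hmaps' t ht)).comp t (hdiv t)).div_const T).congr_deriv ?_
      field_simp
  refine ⟨_, htower, fun t => rfl, ?_⟩
  intro k
  have hmul : MapsTo (fun x => T * x) (Icc 0 1) (Icc 0 T) := fun x hx =>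
    ⟨mul_nonneg hT.le hx.1, by nlinarith [hx.2]⟩
  refine iteratedDeriv_eq_or_eq_zero
    (G := fun k x => T ^ k * tower (b / α) (fun t => u (t / T)) (fun t => u₁ (t / T) / T) k (T * x))
    zero_lt_one ?_ ?_ ?_ k
  · intro x hx
    simp [tower, mul_div_cancel_left₀ x hT.ne']
  · intro k
    exact continuousOn_const.mul ((htower.continuousOn k).comp (by fun_prop) hmul)
  · intro k x hx
    have hx' : T * x ∈ Ioo 0 T := ⟨mul_pos hT hx.1, by nlinarith [hx.2]⟩
    have e1 : HasDerivAt (fun x : ℝ => T * x) T x := by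
      simpa using (hasDerivAt_id x).const_mul T
    refine (((htower.hasDerivAt k _ hx').comp x e1).const_mul (T ^ k)).congr_deriv ?_
    ring

namespace IsTower

variable {β T : ℝ} {F : ℕ → ℝ → ℝ}

lemma le_of_supersolution (hF : IsTower β T F) (hβ : 0 < β) (hT : 0 ≤ T) {w w₁ w₂ : ℝ → ℝ}
    (h₁ : ∀ t, 0 ≤ t → HasDerivAt w (w₁ t) t) (h₂ : ∀ t, 0 ≤ t → HasDerivAt w₁ (w₂ t) t)
    (hL : ∀ t, 0 ≤ t → w₂ t + t * w₁ t - β * w t ≤ 0) (h0 : F 0 0 ≤ w 0) (hFT : F 0 T ≤ w T) :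
    ∀ t ∈ Icc 0 T, F 0 t ≤ w t := by
  intro t ht
  have := nonpos_of_subsolution hβ hT (z := fun t => F 0 t - w t)
    (z₁ := fun t => F 1 t - w₁ t) (z₂ := fun t => F 2 t - w₂ t)
    ((hF.continuousOn 0).sub fun t ht => (h₁ t ht.1).continuousAt.continuousWithinAt)
    (fun t ht => (hF.hasDerivAt 0 t ht).sub (h₁ t ht.1.le))
    (fun t ht => (hF.hasDerivAt 1 t ht).sub (h₂ t ht.1.le)) ?_ (by linarith) (by linarith) t ht
  · linarith
  · intro t ht
    have h3 := hF.recurrence 0 t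
    have h4 := hL t ht.1.le
    norm_num at h3
    linarith

lemma nonneg (hF : IsTower β T F) (hβ : 0 < β) (hT : 0 ≤ T) (h0 : 0 ≤ F 0 0) (hFT : 0 ≤ F 0 T) :
    ∀ t ∈ Icc 0 T, 0 ≤ F 0 t := by
  intro t ht
  have := nonpos_of_subsolution hβ hT (z := fun t => -F 0 t)
    (z₁ := fun t => -F 1 t) (z₂ := fun t => -F 2 t) (hF.continuousOn 0).neg
    (fun t ht => (hF.hasDerivAt 0 t ht).neg) (fun t ht => (hF.hasDerivAt 1 t ht).neg)
    ?_ (by linarith) (by linarith) t ht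
  · linarith
  · intro t ht
    have h3 := hF.recurrence 0 t
    norm_num at h3
    linarith

lemma hasDerivAt_exp_mul (hF : IsTower β T F) {t : ℝ} (ht : t ∈ Ioo 0 T) :
    HasDerivAt (fun t => Real.exp (t ^ 2 / 2) * F 1 t) (Real.exp (t ^ 2 / 2) * (β * F 0 t)) t := by
  have e1 : HasDerivAt (fun t : ℝ => Real.exp (t ^ 2 / 2)) (Real.exp (t ^ 2 / 2) * t) t := by
    refine (((hasDerivAt_pow 2 t).div_const 2).exp).congr_deriv ?_
    norm_num
  refine (e1.mul (hF.hasDerivAt 1 t ht)).congr_deriv ?_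
  have h3 := hF.recurrence 0 t
  norm_num at h3 ⊢
  rw [h3]
  ring

lemma continuousOn_exp_mul (hF : IsTower β T F) :
    ContinuousOn (fun t => Real.exp (t ^ 2 / 2) * F 1 t) (Icc 0 T) :=
  ContinuousOn.mul (by fun_prop) (hF.continuousOn 1)

/-- The initial slope is controlled by the size of the solution near `0`. -/
lemma abs_slope_zero_le (hF : IsTower β T F) (hβ : 0 < β) {δ M : ℝ} (hδ : 0 < δ) (hδ1 : δ ≤ 1)
    (hδT : δ ≤ T) (hM : ∀ t ∈ Icc 0 δ, |F 0 t| ≤ M) :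
    |F 1 0| ≤ Real.exp 1 * (2 / δ + β) * M := by
  have hM0 : 0 ≤ M := (abs_nonneg _).trans (hM 0 ⟨le_rfl, hδ.le⟩)
  have hexp : ∀ t ∈ Icc 0 δ, Real.exp (t ^ 2 / 2) ≤ Real.exp 1 := fun t ht => by
    apply Real.exp_le_exp.2
    nlinarith [ht.1, ht.2]
  obtain ⟨s, hs, hs'⟩ := exists_hasDerivAt_eq_slope (F 0) (F 1) hδ
    ((hF.continuousOn 0).mono (Icc_subset_Icc_right hδT))
    (fun t ht => hF.hasDerivAt 0 t ⟨ht.1, ht.2.trans_le hδT⟩)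
  obtain ⟨r, hr, hr'⟩ := exists_hasDerivAt_eq_slope _ _ hs.1
    (hF.continuousOn_exp_mul.mono (Icc_subset_Icc_right (hs.2.le.trans hδT)))
    (fun t ht => hF.hasDerivAt_exp_mul ⟨ht.1, (ht.2.trans hs.2).trans_le hδT⟩)
  have hsI : s ∈ Icc 0 δ := Ioo_subset_Icc_self hs
  have hrI : r ∈ Icc 0 δ := ⟨hr.1.le, (hr.2.trans hs.2).le⟩
  have h1 : |F 1 s| ≤ 2 / δ * M := by
    rw [hs', sub_zero, abs_div, abs_of_pos hδ, div_mul_eq_mul_div]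
    gcongr
    have := abs_sub (F 0 δ) (F 0 0)
    have := hM δ ⟨hδ.le, le_rfl⟩
    have := hM 0 ⟨le_rfl, hδ.le⟩
    linarith
  have h2 : F 1 0 = Real.exp (s ^ 2 / 2) * F 1 s - s * (Real.exp (r ^ 2 / 2) * (β * F 0 r)) := by
    rw [hr']
    have := hs.1.ne'
    simp
    field_simp
    ring
  have h3 : |Real.exp (s ^ 2 / 2) * F 1 s| ≤ Real.exp 1 * (2 / δ * M) := by
    rw [abs_mul, abs_of_pos (Real.exp_pos _)]
    exact mul_le_mul (hexp s hsI) h1 (abs_nonneg _) (Real.exp_pos _).le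
  have h4 : |s * (Real.exp (r ^ 2 / 2) * (β * F 0 r))| ≤ 1 * (Real.exp 1 * (β * M)) := by
    rw [abs_mul, abs_mul, abs_mul, abs_of_pos (Real.exp_pos _), abs_of_pos hβ, abs_of_pos hs.1]
    have := hexp r hrI
    have := hM r hrI
    have : s ≤ 1 := hsI.2.trans hδ1
    gcongr
  rw [h2]
  calc _ ≤ |Real.exp (s ^ 2 / 2) * F 1 s| + |s * (Real.exp (r ^ 2 / 2) * (β * F 0 r))| :=
        abs_sub _ _
    _ ≤ _ := by linarith

lemma abs_succ_le (β : ℝ) (k : ℕ) : ∃ C > 0, ∀ T M : ℝ, ∀ F : ℕ → ℝ → ℝ, IsTower β T F →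
    (∀ t ∈ Icc 0 T, |F k t| ≤ M * (1 + t) ^ (β - k)) → |F (k + 1) 0| ≤ M →
    ∀ t ∈ Icc 0 T, |F (k + 1) t| ≤ C * M * (1 + t) ^ (β - (k + 1 : ℕ)) := by
  obtain ⟨C, hC, h⟩ := le_rpow_of_first_order (β - k)
  refine ⟨C * (|β - k| + 1), by positivity, ?_⟩
  intro T M F hF hk h0 t ht
  have hM : 0 ≤ M := (abs_nonneg _).trans h0
  have hM' : M ≤ (|β - k| + 1) * M := by nlinarith [abs_nonneg (β - k)]
  have hg : ∀ t ∈ Ioo 0 T, |F (k + 2) t + t * F (k + 1) t| ≤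
      (|β - k| + 1) * M * (1 + t) ^ (β - k) := by
    intro t ht
    have hs : (0 : ℝ) < 1 + t := by linarith [ht.1]
    have h1 := hk t (Ioo_subset_Icc_self ht)
    rw [hF.recurrence k t, sub_add_cancel, abs_mul, mul_assoc]
    have := abs_nonneg (β - k)
    have : 0 ≤ M * (1 + t) ^ (β - k) := by positivity
    nlinarith
  have hpos := h T ((|β - k| + 1) * M) (by positivity) (F (k + 1)) (F (k + 2))
    (hF.continuousOn _) (hF.hasDerivAt _) (fun t ht => (abs_le.1 (hg t ht)).2)
    ((le_abs_self _).trans (h0.trans hM')) t ht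
  have hneg := h T ((|β - k| + 1) * M) (by positivity) (fun t => -F (k + 1) t)
    (fun t => -F (k + 2) t) (hF.continuousOn _).neg (fun t ht => (hF.hasDerivAt _ t ht).neg)
    (fun t ht => by linarith [(abs_le.1 (hg t ht)).1])
    ((neg_le_abs _).trans (h0.trans hM')) t ht
  have hexp : β - (k + 1 : ℕ) = β - k - 1 := by push_cast; ring
  rw [hexp, mul_assoc C]
  exact abs_le.2 ⟨by linarith, hpos⟩

end IsTower

lemma hasDerivAt_const_add_rpow {K t : ℝ} (γ : ℝ) (h : 0 < K + t) :
    HasDerivAt (fun t : ℝ => (K + t) ^ γ) (γ * (K + t) ^ (γ - 1)) t := by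
  simpa using ((hasDerivAt_id t).const_add K).rpow_const (p := γ) (Or.inl h.ne')

lemma rpow_eq_sub_two_mul {s : ℝ} (hs : 0 < s) (γ : ℝ) : s ^ γ = s ^ (γ - 1 - 1) * s ^ 2 := by
  rw [← Real.rpow_natCast s 2, ← Real.rpow_add hs]
  push_cast
  ring_nf

lemma rpow_sub_one_eq_mul {s : ℝ} (hs : 0 < s) (γ : ℝ) : s ^ (γ - 1) = s ^ (γ - 1 - 1) * s := by
  rw [← Real.rpow_add_one hs.ne']
  norm_num

namespace IsTower

variable {β T : ℝ} {F : ℕ → ℝ → ℝ}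

lemma growing_zero_le (hF : IsTower β T F) (hβ : 0 < β) (hT : 0 < T) (h0 : F 0 0 = 0)
    (h1 : F 0 T = 1) : ∀ t ∈ Icc 0 T, |F 0 t| ≤ (1 + β) ^ β * (T ^ (-β) * (1 + t) ^ β) := by
  intro t ht
  rw [abs_of_nonneg (hF.nonneg hβ hT.le h0.ge (by rw [h1]; exact zero_le_one) t ht)]
  set A : ℝ := (1 + β + T) ^ (-β)
  have hA : 0 < A := by positivity
  have hw := hF.le_of_supersolution hβ hT.le (w := fun t => A * (1 + β + t) ^ β)
    (w₁ := fun t => A * (β * (1 + β + t) ^ (β - 1)))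
    (w₂ := fun t => A * (β * ((β - 1) * (1 + β + t) ^ (β - 1 - 1))))
    (fun t ht => (hasDerivAt_const_add_rpow β (by positivity)).const_mul A)
    (fun t ht => ((hasDerivAt_const_add_rpow (β - 1) (by positivity)).const_mul β).const_mul A)
    ?_ (by rw [h0]; positivity) ?_ t ht
  · refine hw.trans ?_
    have ht0 := ht.1
    have e1 : (1 + β + t) ^ β ≤ (1 + β) ^ β * (1 + t) ^ β := by
      rw [← Real.mul_rpow (by positivity) (by positivity)]
      exact Real.rpow_le_rpow (by positivity) (by nlinarith) hβ.le
    have e2 : A ≤ T ^ (-β) :=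
      Real.rpow_le_rpow_of_nonpos hT (by linarith) (by linarith)
    calc A * (1 + β + t) ^ β ≤ T ^ (-β) * ((1 + β) ^ β * (1 + t) ^ β) := by gcongr
      _ = _ := by ring
  · intro t ht
    have hs : 0 < 1 + β + t := by positivity
    rw [rpow_eq_sub_two_mul hs β, rpow_sub_one_eq_mul hs β]
    have e : 0 ≤ A * β * (1 + β + t) ^ (β - 1 - 1) := by positivity
    have e' : (β - 1) - (1 + β) * (1 + β + t) ≤ 0 := by nlinarith
    linarith [mul_nonpos_of_nonneg_of_nonpos e e']
  · rw [h1, ← Real.rpow_add (by positivity)]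
    simp

/-- Bounds, uniform in `T`, for the solution vanishing at `0` and equal to `1` at `T`. -/
theorem growing_abs_le {δ : ℝ} (hβ : 0 < β) (hδ : 0 < δ) (hδ1 : δ ≤ 1) (k : ℕ) :
    ∃ C > 0, ∀ T, δ ≤ T → ∀ F, IsTower β T F → F 0 0 = 0 → F 0 T = 1 →
      ∀ t ∈ Icc 0 T, |F k t| ≤ C * (T ^ (-β) * (1 + t) ^ (β - k)) := by
  have main : (∃ C > 0, ∀ T, δ ≤ T → ∀ F, IsTower β T F → F 0 0 = 0 → F 0 T = 1 →
      ∀ t ∈ Icc 0 T, |F k t| ≤ C * (T ^ (-β) * (1 + t) ^ (β - k))) ∧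
      (∃ C > 0, ∀ T, δ ≤ T → ∀ F, IsTower β T F → F 0 0 = 0 → F 0 T = 1 →
      ∀ t ∈ Icc 0 T, |F (k + 1) t| ≤ C * (T ^ (-β) * (1 + t) ^ (β - (k + 1 : ℕ)))) := by
    induction k with
    | zero =>
      refine ⟨⟨(1 + β) ^ β, by positivity, ?_⟩, ?_⟩
      · intro T hT F hF h0 h1 t ht
        simpa using hF.growing_zero_le hβ (hδ.trans_le hT) h0 h1 t ht
      · obtain ⟨C, hC, h⟩ := abs_succ_le β 0
        set B : ℝ := Real.exp 1 * (2 / δ + β) * ((1 + β) ^ β * 2 ^ β) with hB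
        have hB0 : 0 < B := by positivity
        refine ⟨C * ((1 + β) ^ β + B), by positivity, ?_⟩
        intro T hT F hF h0 h1 t ht
        have hT0 : 0 < T := hδ.trans_le hT
        have hz := hF.growing_zero_le hβ hT0 h0 h1
        refine (h T (((1 + β) ^ β + B) * T ^ (-β)) F hF ?_ ?_ t ht).trans_eq (by ring)
        · intro t ht
          have hs : (0 : ℝ) < 1 + t := by linarith [ht.1]
          refine (hz t ht).trans ?_
          have : 0 ≤ B * T ^ (-β) * (1 + t) ^ β := by positivity
          simp only [Nat.cast_zero, sub_zero]
          linarith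
        · have := hF.abs_slope_zero_le hβ hδ hδ1 hT (M := (1 + β) ^ β * (T ^ (-β) * 2 ^ β)) ?_
          · refine this.trans ?_
            have : 0 ≤ (1 + β) ^ β * T ^ (-β) := by positivity
            rw [hB]
            linarith
          · intro t ht
            refine (hz t ⟨ht.1, ht.2.trans hT⟩).trans ?_
            have := ht.1
            have : 1 + t ≤ 2 := by linarith [ht.2]
            gcongr
    | succ k ih =>
      refine ⟨ih.2, ?_⟩
      obtain ⟨⟨C₀, hC₀, h₀⟩, ⟨C₁, hC₁, h₁⟩⟩ := ih
      obtain ⟨C, hC, h⟩ := abs_succ_le β (k + 1)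
      refine ⟨C * (C₁ + |β - k| * C₀), by positivity, ?_⟩
      intro T hT F hF hF0 hFT t ht
      have hT0 : 0 < T := hδ.trans_le hT
      refine (h T ((C₁ + |β - k| * C₀) * T ^ (-β)) F hF ?_ ?_ t ht).trans_eq (by ring)
      · intro t ht
        have hs : (0 : ℝ) < 1 + t := by linarith [ht.1]
        refine (h₁ T hT F hF hF0 hFT t ht).trans ?_
        have : 0 ≤ |β - k| * C₀ * T ^ (-β) * (1 + t) ^ (β - (k + 1 : ℕ)) := by positivity
        linarith
      · have h2 := h₀ T hT F hF hF0 hFT 0 ⟨le_rfl, hT0.le⟩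
        rw [add_zero, Real.one_rpow, mul_one] at h2
        rw [show k + 1 + 1 = k + 2 from rfl, hF.recurrence k 0, zero_mul, sub_zero, abs_mul]
        have h3 := mul_le_mul_of_nonneg_left h2 (abs_nonneg (β - k))
        have : 0 ≤ C₁ * T ^ (-β) := by positivity
        linarith
  exact main.1

lemma decaying_zero_le (hF : IsTower β T F) (hβ : 0 < β) (hT : 0 < T) (h0 : F 0 0 = 1)
    (h1 : F 0 T = 0) : ∀ t ∈ Icc 0 T,
      F 0 t ≤ (β + 2) ^ (β + 1) * (Real.exp (-t ^ 2 / 2) * (1 + t) ^ (-(β + 1))) := by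
  intro t ht
  set A : ℝ := (β + 2) ^ (β + 1)
  have hA : 0 < A := by positivity
  set γ : ℝ := -(β + 1) with hγ
  have he : ∀ t, HasDerivAt (fun t : ℝ => Real.exp (-t ^ 2 / 2)) (Real.exp (-t ^ 2 / 2) * -t) t := by
    intro t
    refine (((hasDerivAt_pow 2 t).neg.div_const 2).exp).congr_deriv ?_
    simp only [Pi.neg_apply]
    norm_num
    ring
  have hw := hF.le_of_supersolution hβ hT.le
    (w := fun t => A * (Real.exp (-t ^ 2 / 2) * (β + 2 + t) ^ γ))
    (w₁ := fun t => A * (Real.exp (-t ^ 2 / 2) *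
      (γ * (β + 2 + t) ^ (γ - 1) - t * (β + 2 + t) ^ γ)))
    (w₂ := fun t => A * (Real.exp (-t ^ 2 / 2) * (γ * ((γ - 1) * (β + 2 + t) ^ (γ - 1 - 1))
      - 2 * t * (γ * (β + 2 + t) ^ (γ - 1)) + (t ^ 2 - 1) * (β + 2 + t) ^ γ)))
    ?_ ?_ ?_ ?_ (by rw [h1]; positivity) t ht
  · refine hw.trans ?_
    have ht0 := ht.1
    have e1 : (β + 2 + t) ^ γ ≤ (1 + t) ^ γ :=
      Real.rpow_le_rpow_of_nonpos (by linarith) (by linarith) (by linarith)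
    gcongr
  · intro t ht
    have hs : 0 < β + 2 + t := by positivity
    refine (((he t).mul (hasDerivAt_const_add_rpow γ hs)).const_mul A).congr_deriv ?_
    ring
  · intro t ht
    have hs : 0 < β + 2 + t := by positivity
    have e0 := hasDerivAt_const_add_rpow γ hs
    have e1 := (hasDerivAt_const_add_rpow (γ - 1) hs).const_mul γ
    refine (((he t).mul (e1.sub ((hasDerivAt_id t).mul e0))).const_mul A).congr_deriv ?_
    simp only [id, Pi.sub_apply, Pi.mul_apply]
    ring
  · intro t ht
    have hs : 0 < β + 2 + t := by positivity
    rw [rpow_eq_sub_two_mul hs γ, rpow_sub_one_eq_mul hs γ]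
    have e : 0 ≤ A * Real.exp (-t ^ 2 / 2) * (β + 2 + t) ^ (γ - 1 - 1) * (β + 1) := by positivity
    have e' : (β + 2) - (β + 2) * (β + 2 + t) ≤ 0 := by nlinarith
    refine (le_of_eq ?_).trans (mul_nonpos_of_nonneg_of_nonpos e e')
    rw [hγ]
    ring
  · have : A * (β + 2) ^ γ = 1 := by
      rw [← Real.rpow_add (by positivity)]
      simp [hγ]
    simp [h0, this]

lemma decaying_one_abs_le {δ : ℝ} (hβ : 0 < β) (hδ : 0 < δ) (hδ1 : δ ≤ 1 / 2) :
    ∃ C > 0, ∀ T, δ ≤ T → ∀ F, IsTower β T F → F 0 0 = 1 → F 0 T = 0 →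
      ∀ t ∈ Icc 0 T, |F 1 t| ≤ C * (Real.exp (-t ^ 2 / 2) * (1 + t) ^ (-β)) := by
  set A : ℝ := (β + 2) ^ (β + 1) with hA
  have hA0 : 0 < A := by positivity
  set B : ℝ := Real.exp 1 * (2 / δ + β) * A with hB
  have hB0 : 0 < B := by positivity
  set D : ℝ := A * Real.exp 1 * 2 ^ (β + 1) / δ with hD
  have hD0 : 0 < D := by positivity
  refine ⟨B * 2 ^ β + D, by positivity, ?_⟩
  intro T hT F hF h0 h1 t ht
  have hT0 : 0 < T := hδ.trans_le hT
  have hz := hF.decaying_zero_le hβ hT0 h0 h1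
  have hnn := hF.nonneg hβ hT0.le (by rw [h0]; exact zero_le_one) h1.ge
  set g : ℝ → ℝ := fun t => Real.exp (t ^ 2 / 2) * F 1 t with hg
  have hmono : MonotoneOn g (Icc 0 T) := by
    apply monotoneOn_of_hasDerivWithinAt_nonneg (convex_Icc 0 T)
      (f' := fun t => Real.exp (t ^ 2 / 2) * (β * F 0 t)) hF.continuousOn_exp_mul
    · intro t ht
      rw [interior_Icc] at ht
      exact (hF.hasDerivAt_exp_mul ht).hasDerivWithinAt
    · intro t ht
      have := hnn t (interior_subset ht)
      positivity
  have hgneg : ∀ t ∈ Ioo 0 T, g t ≤ 0 := by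
    intro t ht
    obtain ⟨c, hc, hc'⟩ := exists_hasDerivAt_eq_slope (F 0) (F 1) ht.2
      ((hF.continuousOn 0).mono (Icc_subset_Icc_left ht.1.le))
      (fun s hs => hF.hasDerivAt 0 s ⟨ht.1.trans hs.1, hs.2⟩)
    have hcI : c ∈ Icc 0 T := ⟨(ht.1.trans hc.1).le, hc.2.le⟩
    refine (hmono (Ioo_subset_Icc_self ht) hcI hc.1.le).trans ?_
    apply mul_nonpos_of_nonneg_of_nonpos (Real.exp_pos _).le
    rw [hc', h1]
    exact div_nonpos_of_nonpos_of_nonneg (by linarith [hnn t (Ioo_subset_Icc_self ht)])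
      (by linarith [ht.2])
  have hgneg' : g t ≤ 0 := by
    have hcl : closure (Ioo 0 T) = Icc 0 T := closure_Ioo hT0.ne
    exact le_on_closure hgneg (hcl ▸ hF.continuousOn_exp_mul) continuousOn_const (hcl ▸ ht)
  have hs : 0 < 1 + t := by linarith [ht.1]
  have hlow : -((B * 2 ^ β + D) * (1 + t) ^ (-β)) ≤ g t := by
    rcases le_total t δ with htδ | htδ
    · have hslope := hF.abs_slope_zero_le hβ hδ (by linarith) hT (M := A) (by
        intro s hs
        have hsT : s ∈ Icc 0 T := ⟨hs.1, hs.2.trans hT⟩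
        rw [abs_of_nonneg (hnn s hsT)]
        refine (hz s hsT).trans (mul_le_of_le_one_right hA0.le ?_)
        apply mul_le_one₀ (Real.exp_le_one_iff.2 (by nlinarith [sq_nonneg s]))
        · have := hs.1
          positivity
        · exact Real.rpow_le_one_of_one_le_of_nonpos (by linarith [hs.1]) (by linarith))
      have h3 : g 0 ≤ g t := hmono ⟨le_rfl, hT0.le⟩ ht ht.1
      have h4 : g 0 = F 1 0 := by simp [hg]
      have h5 : 1 ≤ (2 : ℝ) ^ β * (1 + t) ^ (-β) := by
        rw [Real.rpow_neg hs.le, ← div_eq_mul_inv, one_le_div (by positivity)]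
        exact Real.rpow_le_rpow hs.le (by linarith) hβ.le
      have h6 : B ≤ B * (2 ^ β * (1 + t) ^ (-β)) := le_mul_of_one_le_right hB0.le h5
      have h7 : 0 ≤ D * (1 + t) ^ (-β) := by positivity
      have := (abs_le.1 hslope).1
      linarith
    · set h : ℝ := δ / (1 + t) with hh
      have hpos : 0 < h := by positivity
      have hht : h * (1 + t) = δ := by rw [hh]; field_simp
      have hhδ : h ≤ δ := div_le_self hδ.le (by linarith [ht.1])
      have hth : 0 ≤ t - h := by linarith
      obtain ⟨c, hc, hc'⟩ := exists_hasDerivAt_eq_slope (F 0) (F 1) (show t - h < t by linarith)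
        ((hF.continuousOn 0).mono (Icc_subset_Icc hth ht.2))
        (fun s hs => hF.hasDerivAt 0 s ⟨hth.trans_lt hs.1, hs.2.trans_le ht.2⟩)
      have hcI : c ∈ Icc 0 T := ⟨hth.trans hc.1.le, hc.2.le.trans ht.2⟩
      have hthI : t - h ∈ Icc 0 T := ⟨hth, by linarith [ht.2]⟩
      refine le_trans ?_ (hmono hcI ht hc.2.le)
      have e1 : -(F 0 (t - h) / h) ≤ F 1 c := by
        rw [hc', sub_sub_cancel, ← neg_div]
        gcongr
        linarith [hnn t ht]
      have e2 : F 0 (t - h) ≤ A * (Real.exp (-(t - h) ^ 2 / 2) * (2 ^ (β + 1) *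
          (1 + t) ^ (-(β + 1)))) := by
        refine (hz _ hthI).trans ?_
        have : (1 + (t - h)) ^ (-(β + 1)) ≤ 2 ^ (β + 1) * (1 + t) ^ (-(β + 1)) := by
          have e3 : (2 : ℝ) ^ (β + 1) * (1 + t) ^ (-(β + 1)) = ((1 + t) / 2) ^ (-(β + 1)) := by
            rw [Real.div_rpow hs.le (by norm_num), Real.rpow_neg (by norm_num : (0 : ℝ) ≤ 2)]
            field_simp
          rw [e3]
          exact Real.rpow_le_rpow_of_nonpos (by linarith) (by linarith) (by linarith)
        gcongr
      have e4 : Real.exp (c ^ 2 / 2) * Real.exp (-(t - h) ^ 2 / 2) ≤ Real.exp 1 := by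
        rw [← Real.exp_add]
        apply Real.exp_le_exp.2
        have := hc.2
        have := hcI.1
        nlinarith
      have e5 : (1 + t) ^ (-β) = (1 + t) ^ (-(β + 1)) * (1 + t) := by
        rw [← Real.rpow_add_one hs.ne']
        ring_nf
      have e6 : Real.exp (c ^ 2 / 2) * (F 0 (t - h) / h) ≤ D * (1 + t) ^ (-β) := by
        calc Real.exp (c ^ 2 / 2) * (F 0 (t - h) / h)
            ≤ Real.exp (c ^ 2 / 2) * (A * (Real.exp (-(t - h) ^ 2 / 2) * (2 ^ (β + 1) *
              (1 + t) ^ (-(β + 1)))) / h) := by gcongr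
          _ = (Real.exp (c ^ 2 / 2) * Real.exp (-(t - h) ^ 2 / 2)) * (A * (2 ^ (β + 1) *
              (1 + t) ^ (-(β + 1))) / h) := by ring
          _ ≤ Real.exp 1 * (A * (2 ^ (β + 1) * (1 + t) ^ (-(β + 1))) / h) := by gcongr
          _ = D * (1 + t) ^ (-β) := by
            rw [e5, hD, hh]
            field_simp
      have e7 := mul_le_mul_of_nonneg_left e1 (Real.exp_pos (c ^ 2 / 2)).le
      have e8 : 0 ≤ B * 2 ^ β * (1 + t) ^ (-β) := by positivity
      simp only [hg]
      linarith
  have hFg : F 1 t = Real.exp (-t ^ 2 / 2) * g t := by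
    simp only [hg]
    rw [← mul_assoc, ← Real.exp_add, neg_div, neg_add_cancel, Real.exp_zero, one_mul]
  rw [hFg, abs_mul, abs_of_pos (Real.exp_pos _), mul_left_comm]
  refine mul_le_mul_of_nonneg_left (abs_le.2 ⟨hlow, hgneg'.trans ?_⟩) (Real.exp_pos _).le
  positivity

/-- Bounds, uniform in `T`, for the solution equal to `1` at `0` and vanishing at `T`. -/
theorem decaying_abs_le {δ : ℝ} (hβ : 0 < β) (hδ : 0 < δ) (hδ1 : δ ≤ 1 / 2) (k : ℕ) :
    ∃ C > 0, ∀ T, δ ≤ T → ∀ F, IsTower β T F → F 0 0 = 1 → F 0 T = 0 →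
      ∀ t ∈ Icc 0 T, |F k t| ≤ C * (Real.exp (-t ^ 2 / 2) * (1 + t) ^ (k - (β + 1))) := by
  have main : (∃ C > 0, ∀ T, δ ≤ T → ∀ F, IsTower β T F → F 0 0 = 1 → F 0 T = 0 →
      ∀ t ∈ Icc 0 T, |F k t| ≤ C * (Real.exp (-t ^ 2 / 2) * (1 + t) ^ (k - (β + 1)))) ∧
      (∃ C > 0, ∀ T, δ ≤ T → ∀ F, IsTower β T F → F 0 0 = 1 → F 0 T = 0 →
      ∀ t ∈ Icc 0 T, |F (k + 1) t| ≤
        C * (Real.exp (-t ^ 2 / 2) * (1 + t) ^ ((k + 1 : ℕ) - (β + 1)))) := by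
    induction k with
    | zero =>
      refine ⟨⟨(β + 2) ^ (β + 1), by positivity, ?_⟩, ?_⟩
      · intro T hT F hF h0 h1 t ht
        have hT0 : 0 < T := hδ.trans_le hT
        rw [abs_of_nonneg (hF.nonneg hβ hT0.le (by rw [h0]; exact zero_le_one) h1.ge t ht)]
        simpa only [Nat.cast_zero, zero_sub] using hF.decaying_zero_le hβ hT0 h0 h1 t ht
      · simpa using decaying_one_abs_le hβ hδ hδ1
    | succ k ih =>
      refine ⟨ih.2, ?_⟩
      obtain ⟨⟨C₀, hC₀, h₀⟩, ⟨C₁, hC₁, h₁⟩⟩ := ih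
      refine ⟨|β - k| * C₀ + C₁, by positivity, ?_⟩
      intro T hT F hF hF0 hFT t ht
      have ht0 := ht.1
      have hs : (0 : ℝ) < 1 + t := by linarith
      have a₀ := h₀ T hT F hF hF0 hFT t ht
      have a₁ := h₁ T hT F hF hF0 hFT t ht
      set E := Real.exp (-t ^ 2 / 2)
      have hE : 0 < E := Real.exp_pos _
      have p₁ : (1 + t) ^ ((k + 1 + 1 : ℕ) - (β + 1)) =
          (1 + t) ^ ((k + 1 : ℕ) - (β + 1)) * (1 + t) := by
        rw [← Real.rpow_add_one hs.ne']
        push_cast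
        ring_nf
      have p₀ : (1 + t) ^ (k - (β + 1)) ≤ (1 + t) ^ ((k + 1 + 1 : ℕ) - (β + 1)) := by
        apply Real.rpow_le_rpow_of_exponent_le (by linarith)
        push_cast
        linarith
      rw [show k + 1 + 1 = k + 2 from rfl, hF.recurrence k t] at *
      calc |(β - k) * F k t - t * F (k + 1) t|
          ≤ |(β - k) * F k t| + |t * F (k + 1) t| := abs_sub _ _
        _ = |β - k| * |F k t| + t * |F (k + 1) t| := by
          rw [abs_mul, abs_mul, abs_of_nonneg ht0]
        _ ≤ |β - k| * (C₀ * (E * (1 + t) ^ ((k + 2 : ℕ) - (β + 1)))) +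
            (1 + t) * (C₁ * (E * (1 + t) ^ ((k + 1 : ℕ) - (β + 1)))) := by
          gcongr
          · exact a₀.trans (by gcongr)
          · linarith
        _ = _ := by rw [p₁]; ring
  exact main.1

end IsTower

lemma rpow_le_rpow_abs {s c : ℝ} (γ : ℝ) (hs : 1 ≤ s) (hc : s ≤ c) : s ^ γ ≤ c ^ |γ| :=
  (Real.rpow_le_rpow_of_exponent_le hs (le_abs_self γ)).trans
    (Real.rpow_le_rpow (by linarith) hc (abs_nonneg γ))

lemma one_add_rpow_le {t a : ℝ} (γ : ℝ) (ha : 0 < a) (hat : a ≤ t) :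
    (1 + t) ^ γ ≤ (1 + 1 / a) ^ |γ| * t ^ γ := by
  have ht : 0 < t := ha.trans_le hat
  have h1 : 1 + t = (1 + 1 / t) * t := by
    field_simp
    ring
  rw [h1, Real.mul_rpow (by positivity) ht.le]
  have h2 : (0 : ℝ) ≤ 1 / t := by positivity
  have h3 : 1 / t ≤ 1 / a := one_div_le_one_div_of_le ha hat
  gcongr
  exact rpow_le_rpow_abs γ (by linarith) (by linarith)

lemma sqrt_div_rpow {α ε : ℝ} (γ : ℝ) (hα : 0 < α) (hε : 0 < ε) :
    √(α / ε) ^ γ = α ^ (γ / 2) * ε ^ (-γ / 2) := by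
  rw [Real.sqrt_eq_rpow, ← Real.rpow_mul (by positivity), Real.div_rpow hα.le hε.le,
    div_eq_mul_inv, ← Real.rpow_neg hε.le]
  ring_nf

end TurningPoint

/-- Two-regime derivative bounds for the homogeneous solutions `μ₀, μ₁` of the
frozen-coefficient operator `L̃ u = -ε u'' - α x u' + b₀ u`
(case `p'(0) = -α < 0`), with `β = b₀/α` and transition point `ρ = C₀ √ε`. -/
theorem stmt17 (α b₀ : ℝ) (hα : 0 < α) (hb₀ : 0 < b₀) :
    ∃ C₀ ≥ (1 : ℝ), ∀ k : ℕ, ∃ C > 0, ∀ ε ∈ Ioc (0 : ℝ) 1,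
      ∀ μ₀ μ₁ : ℝ → ℝ,
      ContDiffOn ℝ 2 μ₀ (Icc (0 : ℝ) 1) →
      (∀ x ∈ Ioo (0 : ℝ) 1,
        -ε * deriv (deriv μ₀) x - α * x * deriv μ₀ x + b₀ * μ₀ x = 0) →
      μ₀ 0 = 0 → μ₀ 1 = 1 →
      ContDiffOn ℝ 2 μ₁ (Icc (0 : ℝ) 1) →
      (∀ x ∈ Ioo (0 : ℝ) 1,
        -ε * deriv (deriv μ₁) x - α * x * deriv μ₁ x + b₀ * μ₁ x = 0) →
      μ₁ 0 = 1 → μ₁ 1 = 0 →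
      -- (i) inner regime 0 ≤ x ≤ C₀√ε
      (∀ x, 0 ≤ x → x ≤ C₀ * Real.sqrt ε → x ≤ 1 →
        |iteratedDeriv k μ₀ x| ≤ C * ε ^ ((b₀ / α - (k : ℝ)) / 2) ∧
        |iteratedDeriv k μ₁ x| ≤ C * ε ^ (-(k : ℝ) / 2)) ∧
      -- (ii) outer regime C₀√ε ≤ x ≤ 1
      (∀ x, C₀ * Real.sqrt ε ≤ x → x ≤ 1 →
        |iteratedDeriv k μ₀ x| ≤
          C * (Real.exp (-α * x ^ 2 / (2 * ε)) *
              ε ^ (b₀ / α + 1 / 2 - (k : ℝ)) *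
              x ^ (-(b₀ / α) + (k : ℝ) - 1) +
            x ^ (b₀ / α - (k : ℝ))) ∧
        |iteratedDeriv k μ₁ x| ≤
          C * (Real.exp (-α * x ^ 2 / (2 * ε)) *
              ε ^ ((b₀ / α + 1) / 2 - (k : ℝ)) *
              x ^ (-(b₀ / α) + (k : ℝ) - 1) +
            Real.exp (-α / (2 * ε)) * ε ^ ((b₀ / α + 1) / 2) *
              x ^ (b₀ / α - (k : ℝ)))) := by
  set β : ℝ := b₀ / α with hβdef
  have hβ : 0 < β := div_pos hb₀ hα
  have hsα : 0 < √α := Real.sqrt_pos.2 hα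
  set δ : ℝ := min (1 / 2) (√α) with hδdef
  have hδ : 0 < δ := lt_min (by norm_num) hsα
  have hδ2 : δ ≤ 1 / 2 := min_le_left _ _
  refine ⟨1, le_rfl, fun k => ?_⟩
  obtain ⟨A, hA, hgrow⟩ := TurningPoint.IsTower.growing_abs_le hβ hδ (by linarith) k
  obtain ⟨B, hB, hdecay⟩ := TurningPoint.IsTower.decaying_abs_le hβ hδ hδ2 k
  set C₁ : ℝ := A * (1 + √α) ^ |β - k| * α ^ ((k - β) / 2) with hC₁
  set C₂ : ℝ := B * (1 + √α) ^ |k - (β + 1)| * α ^ ((k : ℝ) / 2) with hC₂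
  set C₃ : ℝ := A * (1 + 1 / √α) ^ |β - k| with hC₃
  set C₄ : ℝ := B * (1 + 1 / √α) ^ |k - (β + 1)| * α ^ ((2 * k - (β + 1)) / 2) with hC₄
  have hC₁0 : 0 < C₁ := by positivity
  have hC₂0 : 0 < C₂ := by positivity
  have hC₃0 : 0 < C₃ := by positivity
  have hC₄0 : 0 < C₄ := by positivity
  refine ⟨C₁ + C₂ + C₃ + C₄, by positivity, ?_⟩
  intro ε hε μ₀ μ₁ hμ₀ hode₀ h00 h01 hμ₁ hode₁ h10 h11
  have hε0 : 0 < ε := hε.1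
  have hsε : 0 < √ε := Real.sqrt_pos.2 hε0
  set T : ℝ := √(α / ε) with hT
  have hT0 : 0 < T := Real.sqrt_pos.2 (by positivity)
  have hT2 : T ^ 2 = α / ε := Real.sq_sqrt (by positivity)
  have hεT : ε * T ^ 2 = α := by rw [hT2]; field_simp
  have hTε : T * √ε = √α := by
    rw [hT, ← Real.sqrt_mul (by positivity), div_mul_cancel₀ _ hε0.ne']
  have hδT : δ ≤ T := by
    refine (min_le_right _ _).trans (Real.sqrt_le_sqrt ?_)
    rw [le_div_iff₀ hε0]
    nlinarith [hε.2]
  obtain ⟨F, hF, hF0, hFk⟩ := TurningPoint.exists_isTower hα hT0 hεT hμ₀ hode₀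
  obtain ⟨G, hG, hG0, hGk⟩ := TurningPoint.exists_isTower hα hT0 hεT hμ₁ hode₁
  have hTx : ∀ x, 0 ≤ x → x ≤ 1 → T * x ∈ Icc 0 T := fun x h0 h1 =>
    ⟨by positivity, mul_le_of_le_one_right hT0.le h1⟩
  have hpow : T ^ k = T ^ (k : ℝ) := (Real.rpow_natCast T k).symm
  have bound₀ : ∀ x, 0 ≤ x → x ≤ 1 →
      |iteratedDeriv k μ₀ x| ≤ A * (T ^ (k - β) * (1 + T * x) ^ (β - k)) := by
    intro x h0 h1
    have hF' := hgrow T hδT F hF (by simp [hF0, h00]) (by simp [hF0, hT0.ne', h01]) _ (hTx x h0 h1)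
    have : T ^ k * |F k (T * x)| ≤ A * (T ^ (k - β) * (1 + T * x) ^ (β - k)) := by
      calc T ^ k * |F k (T * x)| ≤ T ^ k * (A * (T ^ (-β) * (1 + T * x) ^ (β - k))) := by gcongr
        _ = A * (T ^ (k - β) * (1 + T * x) ^ (β - k)) := by
          rw [sub_eq_add_neg (k : ℝ) β, Real.rpow_add hT0, hpow]
          ring
    rcases hFk k x ⟨h0, h1⟩ with h | h
    · rwa [h, abs_mul, abs_of_pos (pow_pos hT0 k)]
    · rw [h, abs_zero]
      positivity
  have bound₁ : ∀ x, 0 ≤ x → x ≤ 1 →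
      |iteratedDeriv k μ₁ x| ≤
        B * (T ^ (k : ℝ) * (Real.exp (-α * x ^ 2 / (2 * ε)) * (1 + T * x) ^ (k - (β + 1)))) := by
    intro x h0 h1
    have hG' := hdecay T hδT G hG (by simp [hG0, h10]) (by simp [hG0, hT0.ne', h11]) _ (hTx x h0 h1)
    have hexp : -(T * x) ^ 2 / 2 = -α * x ^ 2 / (2 * ε) := by
      rw [mul_pow, hT2]
      field_simp
    rw [hexp] at hG'
    have : T ^ k * |G k (T * x)| ≤
        B * (T ^ (k : ℝ) * (Real.exp (-α * x ^ 2 / (2 * ε)) * (1 + T * x) ^ (k - (β + 1)))) := by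
      rw [← hpow, mul_left_comm]
      gcongr
    rcases hGk k x ⟨h0, h1⟩ with h | h
    · rwa [h, abs_mul, abs_of_pos (pow_pos hT0 k)]
    · rw [h, abs_zero]
      positivity
  constructor
  · intro x h0 hxε h1
    have ht : 1 + T * x ≤ 1 + √α := by
      rw [← hTε]
      rw [one_mul] at hxε
      gcongr
    have ht0 : 0 ≤ T * x := by positivity
    constructor
    · calc |iteratedDeriv k μ₀ x| ≤ A * (T ^ (k - β) * (1 + T * x) ^ (β - k)) := bound₀ x h0 h1
        _ ≤ A * (T ^ (k - β) * (1 + √α) ^ |β - k|) := by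
          gcongr
          exact TurningPoint.rpow_le_rpow_abs _ (by linarith) ht
        _ = C₁ * ε ^ ((β - k) / 2) := by
          rw [hT, TurningPoint.sqrt_div_rpow _ hα hε0, hC₁, neg_sub]
          ring
        _ ≤ _ := by
          gcongr
          linarith
    · calc |iteratedDeriv k μ₁ x| ≤ B * (T ^ (k : ℝ) *
            (Real.exp (-α * x ^ 2 / (2 * ε)) * (1 + T * x) ^ (k - (β + 1)))) := bound₁ x h0 h1
        _ ≤ B * (T ^ (k : ℝ) * (1 * (1 + √α) ^ |k - (β + 1)|)) := by
          gcongr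
          · rw [Real.exp_le_one_iff, neg_mul, neg_div, neg_nonpos]
            positivity
          · exact TurningPoint.rpow_le_rpow_abs _ (by linarith) ht
        _ = C₂ * ε ^ (-(k : ℝ) / 2) := by
          rw [hT, TurningPoint.sqrt_div_rpow _ hα hε0, hC₂]
          ring
        _ ≤ _ := by
          gcongr
          linarith
  · intro x hxε h1
    rw [one_mul] at hxε
    have hx0 : 0 < x := hsε.trans_le hxε
    have ht : √α ≤ T * x := by
      rw [← hTε]
      gcongr
    constructor
    · calc |iteratedDeriv k μ₀ x| ≤ A * (T ^ (k - β) * (1 + T * x) ^ (β - k)) :=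
            bound₀ x hx0.le h1
        _ ≤ A * (T ^ (k - β) * ((1 + 1 / √α) ^ |β - k| * (T * x) ^ (β - k))) := by
          gcongr
          exact TurningPoint.one_add_rpow_le _ hsα ht
        _ = C₃ * x ^ (β - k) := by
          have : T ^ (k - β) * T ^ (β - k) = 1 := by
            rw [← Real.rpow_add hT0]
            simp
          rw [Real.mul_rpow hT0.le hx0.le, hC₃]
          linear_combination (A * (1 + 1 / √α) ^ |β - k| * x ^ (β - k)) * this
        _ ≤ (C₁ + C₂ + C₃ + C₄) * x ^ (β - k) := by
          gcongr
          linarith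
        _ ≤ _ := by
          gcongr
          exact le_add_of_nonneg_left (by positivity)
    · calc |iteratedDeriv k μ₁ x| ≤ B * (T ^ (k : ℝ) *
            (Real.exp (-α * x ^ 2 / (2 * ε)) * (1 + T * x) ^ (k - (β + 1)))) := bound₁ x hx0.le h1
        _ ≤ B * (T ^ (k : ℝ) * (Real.exp (-α * x ^ 2 / (2 * ε)) *
            ((1 + 1 / √α) ^ |k - (β + 1)| * (T * x) ^ (k - (β + 1))))) := by
          gcongr
          exact TurningPoint.one_add_rpow_le _ hsα ht
        _ = C₄ * (Real.exp (-α * x ^ 2 / (2 * ε)) * ε ^ ((β + 1) / 2 - k) *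
            x ^ (-β + k - 1)) := by
          have h2 : T ^ (k : ℝ) * T ^ (k - (β + 1)) =
              α ^ ((2 * k - (β + 1)) / 2) * ε ^ ((β + 1) / 2 - k) := by
            rw [← Real.rpow_add hT0, hT, TurningPoint.sqrt_div_rpow _ hα hε0]
            ring_nf
          have h3 : k - (β + 1) = -β + k - 1 := by ring
          rw [Real.mul_rpow hT0.le hx0.le, hC₄, ← h3]
          linear_combination (B * Real.exp (-α * x ^ 2 / (2 * ε)) *
            (1 + 1 / √α) ^ |k - (β + 1)| * x ^ (k - (β + 1))) * h2
        _ ≤ (C₁ + C₂ + C₃ + C₄) * (Real.exp (-α * x ^ 2 / (2 * ε)) * ε ^ ((β + 1) / 2 - k) *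
            x ^ (-β + k - 1)) := by
          gcongr
          linarith
        _ ≤ _ := by
          gcongr
          exact le_add_of_nonneg_right (by positivity)
end

section
/- Let α > 0, b₀ > 0, M > 0. Then there exists a constant C > 0 such that for every ε ∈ (0,1], every continuous h : [0,1] → ℝ with |h(x)| ≤ M for all x, and every u₂ ∈ C²([0,1]) satisfying -ε u₂''(x) + α x u₂'(x) + b₀ u₂(x) = x h(x) on (0,1) with u₂(0) = u₂(1) = 0, one has |u₂'(x)| ≤ C (1 + (max{x, √ε})^{-1}) for all x ∈ [0, 1/2]. -/
open Set

open Filter Topology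

/-- A function with derivative `v` bounded in absolute value by `K` cannot have `v` lying above a
positive decreasing line for too long; the line is a strict subsolution for `v`. -/
lemma sub_mul_mul_le_of_line_barrier {u v w : ℝ → ℝ} {x₀ d s K : ℝ} (hd : 0 < d) (hs : 0 ≤ s)
    (hu : ∀ x ∈ Icc x₀ (x₀ + d), HasDerivAt u (v x) x)
    (hv : ∀ x ∈ Icc x₀ (x₀ + d), HasDerivAt v (w x) x)
    (hK : ∀ x ∈ Icc x₀ (x₀ + d), |u x| ≤ K)
    (hw : ∀ x ∈ Ico x₀ (x₀ + d), v x = v x₀ - s * (x - x₀) → -s < w x) :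
    (v x₀ - s * d) * d ≤ 2 * K := by
  have hline : ∀ x, HasDerivAt (fun y => v x₀ - s * (y - x₀)) (-s) x := fun x => by
    simpa using (((hasDerivAt_id x).sub_const x₀).const_mul s).const_sub (v x₀)
  have hlow : ∀ ⦃x⦄, x ∈ Icc x₀ (x₀ + d) → v x₀ - s * (x - x₀) ≤ v x :=
    image_le_of_deriv_right_lt_deriv_boundary'
      (fun x _ => (hline x).continuousAt.continuousWithinAt)
      (fun x _ => (hline x).hasDerivWithinAt) (by simp)
      (fun x hx => (hv x hx).continuousAt.continuousWithinAt)
      (fun x hx => (hv x (Ico_subset_Icc_self hx)).hasDerivWithinAt)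
      (fun x hx hxeq => hw x hx hxeq.symm)
  obtain ⟨c, hc, hcu⟩ := exists_hasDerivAt_eq_slope u v (show x₀ < x₀ + d by linarith)
    (fun x hx => (hu x hx).continuousAt.continuousWithinAt)
    (fun x hx => hu x (Ioo_subset_Icc_self hx))
  have hc' := hlow (Ioo_subset_Icc_self hc)
  have hsc : s * (c - x₀) ≤ s * d := mul_le_mul_of_nonneg_left (by linarith [hc.2]) hs
  have h₁ := abs_le.1 (hK x₀ ⟨le_rfl, by linarith⟩)
  have h₂ := abs_le.1 (hK (x₀ + d) ⟨by linarith, le_rfl⟩)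
  have hvc : v c * d = u (x₀ + d) - u x₀ := by
    rw [hcu, add_sub_cancel_left, div_mul_cancel₀ _ hd.ne']
  calc (v x₀ - s * d) * d ≤ v c * d := mul_le_mul_of_nonneg_right (by linarith) hd.le
    _ ≤ 2 * K := by linarith [h₁.1, h₂.2]

/-- Weak maximum principle for `-ε u'' + p u' + b₀ u` on `[0,1]`. -/
lemma le_div_of_maximum_principle {u p f : ℝ → ℝ} {ε b₀ M : ℝ} (hε : 0 < ε) (hb₀ : 0 < b₀)
    (hM : 0 < M) (hu : ContinuousOn u (Icc 0 1))
    (hode : ∀ x ∈ Ioo (0 : ℝ) 1, -ε * deriv (deriv u) x + p x * deriv u x + b₀ * u x = f x)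
    (hf : ∀ x ∈ Ioo (0 : ℝ) 1, f x ≤ M) (h0 : u 0 = 0) (h1 : u 1 = 0) :
    ∀ x ∈ Icc (0 : ℝ) 1, u x ≤ M / b₀ := by
  obtain ⟨c, hc, hmax⟩ := isCompact_Icc.exists_isMaxOn (nonempty_Icc.2 zero_le_one) hu
  intro x hx
  refine (hmax hx).trans ?_
  by_contra! hlt
  have hpos : 0 < u c := (div_pos hM hb₀).trans hlt
  have hc' : c ∈ Ioo (0 : ℝ) 1 := by
    refine ⟨lt_of_le_of_ne hc.1 ?_, lt_of_le_of_ne hc.2 ?_⟩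
    · rintro rfl; linarith
    · rintro rfl; linarith
  have hloc : IsLocalMax u c := hmax.isLocalMax (Icc_mem_nhds hc'.1 hc'.2)
  have hderiv : deriv u c = 0 := hloc.deriv_eq_zero
  have heq := hode c hc'
  have hfc := hf c hc'
  rw [div_lt_iff₀ hb₀] at hlt
  have hdd : 0 < deriv (deriv u) c := by
    rw [hderiv] at heq
    refine pos_of_mul_pos_right (?_ : 0 < ε * deriv (deriv u) c) hε.le
    linarith
  have hmin : IsLocalMin u c := isLocalMin_of_deriv_deriv_pos hdd hderiv
    (hu.continuousAt (Icc_mem_nhds hc'.1 hc'.2))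
  have hconst : u =ᶠ[𝓝 c] fun _ => u c := by
    filter_upwards [hloc, hmin] with y hy₁ hy₂ using le_antisymm hy₁ hy₂
  have hzero : deriv (deriv u) c = 0 := by
    rw [hconst.deriv.deriv_eq]; simp
  linarith

lemma deriv_le_of_frozen_ode {u v w f : ℝ → ℝ} {α b₀ M ε : ℝ} (hα : 0 < α) (hb₀ : 0 < b₀)
    (hM : 0 < M) (hε : ε ∈ Ioc (0 : ℝ) 1)
    (hu : ∀ x ∈ Ioo (0 : ℝ) 1, HasDerivAt u (v x) x)
    (hv : ∀ x ∈ Ioo (0 : ℝ) 1, HasDerivAt v (w x) x)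
    (hode : ∀ x ∈ Ioo (0 : ℝ) 1, -ε * w x + α * x * v x + b₀ * u x = f x)
    (hf : ∀ x ∈ Ioo (0 : ℝ) 1, |f x| ≤ M)
    (hK : ∀ x ∈ Ioo (0 : ℝ) 1, |u x| ≤ M / b₀) {x : ℝ} (hx : x ∈ Ioc (0 : ℝ) (1 / 2)) :
    v x ≤ (24 * (M / b₀) + 3 * (M / α) + 3 * M) * (1 + (max x (Real.sqrt ε))⁻¹) := by
  obtain ⟨hε0, hε1⟩ := hε
  obtain ⟨hx0, hx1⟩ := hx
  set r := Real.sqrt ε with hr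
  have hr0 : 0 < r := Real.sqrt_pos.2 hε0
  have hr1 : r ≤ 1 := Real.sqrt_le_one.2 hε1
  have hrr : r * r = ε := Real.mul_self_sqrt hε0.le
  have hKpos : 0 < M / b₀ := div_pos hM hb₀
  have hMα : 0 < M / α := div_pos hM hα
  have hsub : ∀ d ≤ (1 / 4 : ℝ), ∀ y ∈ Icc x (x + d), y ∈ Ioo (0 : ℝ) 1 :=
    fun d hd y hy => ⟨by linarith [hy.1], by linarith [hy.2]⟩
  have hres : ∀ y ∈ Ioo (0 : ℝ) 1, α * y * v y - 2 * M ≤ ε * w y := by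
    intro y hy
    have h₁ := (abs_le.1 (hf y hy)).2
    have h₂ := (abs_le.1 (hK y hy)).1
    have h₃ := hode y hy
    have h₄ : b₀ * (M / b₀) = M := by field_simp
    nlinarith
  rcases le_total r x with hrx | hxr
  · rw [max_eq_left hrx]
    have hxi : 0 < x⁻¹ := inv_pos.2 hx0
    by_cases hV : v x ≤ 3 * (M / α) * x⁻¹
    · nlinarith [mul_pos hKpos hxi, mul_pos hM hxi]
    · push Not at hV
      have hV' : 3 * M < α * x * v x := by
        calc 3 * M = α * x * (3 * (M / α) * x⁻¹) := by field_simp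
          _ < α * x * v x := mul_lt_mul_of_pos_left hV (mul_pos hα hx0)
      have hvpos : 0 < v x := lt_trans (by positivity) hV
      have := sub_mul_mul_le_of_line_barrier (x₀ := x) (d := 1 / 4) (s := 0) (u := u) (v := v)
        (w := w) (K := M / b₀) (by norm_num) le_rfl
        (fun y hy => hu y (hsub _ le_rfl y hy)) (fun y hy => hv y (hsub _ le_rfl y hy))
        (fun y hy => hK y (hsub _ le_rfl y hy)) (by
          intro y hy hvy
          have hy' := hres y (hsub _ le_rfl y (Ico_subset_Icc_self hy))
          have hvy' : v y = v x := by linarith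
          rw [hvy'] at hy'
          have hmono : α * x * v x ≤ α * y * v x := by
            have := hy.1
            gcongr
          have : 0 < ε * w y := by linarith
          linarith [pos_of_mul_pos_right this hε0.le])
      nlinarith [mul_pos hKpos hxi, mul_pos hM hxi, mul_pos hMα hxi]
  · rw [max_eq_right hxr]
    have hri : 0 < r⁻¹ := inv_pos.2 hr0
    by_cases hV : v x ≤ 3 * M * r⁻¹
    · nlinarith [mul_pos hKpos hri, mul_pos hMα hri]
    · push Not at hV
      have hd : r / 4 ≤ 1 / 4 := by linarith
      have hsd : 3 * M / ε * (r / 4) = 3 / 4 * M * r⁻¹ := by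
        rw [← hrr]; field_simp
      have hMr : 0 < M * r⁻¹ := mul_pos hM hri
      have := sub_mul_mul_le_of_line_barrier (x₀ := x) (d := r / 4) (s := 3 * M / ε) (u := u)
        (v := v) (w := w) (K := M / b₀) (by positivity) (by positivity)
        (fun y hy => hu y (hsub _ hd y hy)) (fun y hy => hv y (hsub _ hd y hy))
        (fun y hy => hK y (hsub _ hd y hy)) (by
          intro y hy hvy
          have hyI := hsub _ hd y (Ico_subset_Icc_self hy)
          have hy' := hres y hyI
          have hle : 3 * M / ε * (y - x) ≤ 3 * M / ε * (r / 4) :=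
            mul_le_mul_of_nonneg_left (by linarith [hy.2]) (by positivity)
          have hvy0 : 0 < v y := by linarith
          have : 0 < α * y * v y := mul_pos (mul_pos hα hyI.1) hvy0
          rw [neg_lt_iff_pos_add]
          refine pos_of_mul_pos_right (?_ : 0 < ε * (w y + 3 * M / ε)) hε0.le
          rw [mul_add, mul_div_cancel₀ _ hε0.ne']
          linarith)
      rw [hsd] at this
      have hhalf : v x / 2 * (r / 4) ≤ 2 * (M / b₀) :=
        (mul_le_mul_of_nonneg_right (by linarith) (by positivity)).trans this
      have hfin : v x ≤ 16 * (M / b₀) * r⁻¹ := by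
        rw [← div_eq_mul_inv, le_div_iff₀ hr0]; linarith
      nlinarith [mul_pos hKpos hri, mul_pos hMα hri]

/-- Green's function estimate for the frozen-coefficient problem with
`p'(0) = α > 0`: if `-ε u₂'' + α x u₂' + b₀ u₂ = x h(x)` with `|h| ≤ M` and
`u₂(0) = u₂(1) = 0`, then `|u₂'(x)| ≤ C (1 + max{x,√ε}^{-1})` on `[0,1/2]`,
uniformly in `ε ∈ (0,1]`. -/
theorem stmt18 (α b₀ M : ℝ) (hα : 0 < α) (hb₀ : 0 < b₀) (hM : 0 < M) :
    ∃ C > 0, ∀ ε ∈ Ioc (0 : ℝ) 1, ∀ h : ℝ → ℝ,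
      ContinuousOn h (Icc (0 : ℝ) 1) →
      (∀ x ∈ Icc (0 : ℝ) 1, |h x| ≤ M) →
      ∀ u₂ : ℝ → ℝ, ContDiffOn ℝ 2 u₂ (Icc (0 : ℝ) 1) →
      (∀ x ∈ Ioo (0 : ℝ) 1,
        -ε * deriv (deriv u₂) x + α * x * deriv u₂ x + b₀ * u₂ x = x * h x) →
      u₂ 0 = 0 → u₂ 1 = 0 →
      ∀ x ∈ Icc (0 : ℝ) (1 / 2),
        |deriv u₂ x| ≤ C * (1 + (max x (Real.sqrt ε))⁻¹) := by
  refine ⟨24 * (M / b₀) + 3 * (M / α) + 3 * M, by positivity, ?_⟩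
  intro ε hε h _ hh u hu hode h0 h1
  have hf : ∀ x ∈ Ioo (0 : ℝ) 1, |x * h x| ≤ M := fun x hx => by
    rw [abs_mul, abs_of_pos hx.1]
    nlinarith [hh x (Ioo_subset_Icc_self hx), abs_nonneg (h x), hx.1, hx.2]
  have hu' : ∀ x ∈ Ioo (0 : ℝ) 1, HasDerivAt u (deriv u x) x := fun x hx =>
    ((hu.contDiffAt (Icc_mem_nhds hx.1 hx.2)).differentiableAt (by norm_num)).hasDerivAt
  have hv' : ∀ x ∈ Ioo (0 : ℝ) 1, HasDerivAt (deriv u) (deriv (deriv u) x) x := fun x hx =>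
    ((((hu.mono Ioo_subset_Icc_self).deriv_of_isOpen isOpen_Ioo
      (show (1 : WithTop ℕ∞) + 1 ≤ 2 by norm_num)).contDiffAt
        (isOpen_Ioo.mem_nhds hx)).differentiableAt (by norm_num)).hasDerivAt
  have hupper := le_div_of_maximum_principle (p := fun x => α * x) hε.1 hb₀ hM hu.continuousOn
    hode (fun x hx => (abs_le.1 (hf x hx)).2) h0 h1
  have hlower := le_div_of_maximum_principle (u := -u) (p := fun x => α * x)
    (f := fun x => -(x * h x)) hε.1 hb₀ hM hu.continuousOn.neg
    (fun x hx => by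
      have hd : deriv (-u) = -deriv u := deriv.neg'
      rw [hd, deriv.neg, Pi.neg_apply, Pi.neg_apply]
      linarith [hode x hx])
    (fun x hx => by linarith [(abs_le.1 (hf x hx)).1]) (by simp [h0]) (by simp [h1])
  have hK : ∀ x ∈ Ioo (0 : ℝ) 1, |u x| ≤ M / b₀ := fun x hx => by
    have h₁ := hupper x (Ioo_subset_Icc_self hx)
    have h₂ := hlower x (Ioo_subset_Icc_self hx)
    rw [Pi.neg_apply] at h₂
    exact abs_le.2 ⟨by linarith, h₁⟩
  have hpos : ∀ x ∈ Ioc (0 : ℝ) (1 / 2), |deriv u x| ≤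
      (24 * (M / b₀) + 3 * (M / α) + 3 * M) * (1 + (max x (Real.sqrt ε))⁻¹) := fun x hx => by
    refine abs_le'.2 ⟨deriv_le_of_frozen_ode hα hb₀ hM hε hu' hv' hode hf hK hx, ?_⟩
    refine deriv_le_of_frozen_ode (u := fun y => -u y) (v := fun y => -deriv u y)
      (w := fun y => -deriv (deriv u) y) (f := fun y => -(y * h y)) hα hb₀ hM hε
      (fun y hy => (hu' y hy).neg) (fun y hy => (hv' y hy).neg)
      (fun y hy => ?_) (fun y hy => ?_) (fun y hy => ?_) hx
    · linarith [hode y hy]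
    · rw [abs_neg]; exact hf y hy
    · rw [abs_neg]; exact hK y hy
  intro x hx
  rcases hx.1.eq_or_lt with rfl | hx0
  swap
  · exact hpos x ⟨hx0, hx.2⟩
  have hr0 : 0 < Real.sqrt ε := Real.sqrt_pos.2 hε.1
  by_cases hdiff : DifferentiableAt ℝ u 0
  swap
  · rw [deriv_zero_of_not_differentiableAt hdiff, abs_zero]
    positivity
  have huniq := uniqueDiffOn_Icc (zero_lt_one' ℝ)
  have h0mem : (0 : ℝ) ∈ Icc (0 : ℝ) 1 := left_mem_Icc.2 zero_le_one
  rw [← hdiff.derivWithin (huniq 0 h0mem)]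
  have hcont : ContinuousOn (derivWithin u (Icc 0 1)) (Icc 0 1) :=
    hu.continuousOn_derivWithin huniq (by norm_num)
  have hlim : Tendsto (derivWithin u (Icc 0 1)) (𝓝[>] 0) (𝓝 (derivWithin u (Icc 0 1) 0)) := by
    rw [← nhdsWithin_Ioo_eq_nhdsGT (zero_lt_one' ℝ)]
    exact (hcont 0 h0mem).mono_left (nhdsWithin_mono _ Ioo_subset_Icc_self)
  have hrhs : ContinuousAt (fun y => (24 * (M / b₀) + 3 * (M / α) + 3 * M) *
      (1 + (max y (Real.sqrt ε))⁻¹)) 0 := by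
    have : max 0 (Real.sqrt ε) ≠ 0 := (lt_max_of_lt_right hr0).ne'
    fun_prop (disch := assumption)
  refine le_of_tendsto_of_tendsto hlim.abs (hrhs.tendsto.mono_left nhdsWithin_le_nhds) ?_
  filter_upwards [Ioo_mem_nhdsGT (show (0 : ℝ) < 1 / 2 by norm_num)] with y hy
  rw [derivWithin_of_mem_nhds (Icc_mem_nhds hy.1 (by linarith [hy.2]))]
  exact hpos y ⟨hy.1, hy.2.le⟩
end
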